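/- arXiv:1401.1225 — 7 statements merged into one kernel-verified Lean document; each statement's English description precedes it below -/
import Mathlib

section
/- There exist finite posets P and Q such that the maximum size of a semiantichain in the product poset P×Q is strictly smaller than the minimum number of unichains needed to cover P×Q. (This disproves the Saks-West conjecture.) -/
/-- A *unichain* in the product of two posets: a chain of the form `{p} × C`
or `C × {q}`. -/
def IsUnichain {α β : Type*} [PartialOrder α] [PartialOrder β] (U : Set (α × β)) : Prop :=
  (∃ (p : α) (C : Set β), IsChain (· ≤ ·) C ∧ U = ({p} : Set α) ×ˢ C) ∨
  (∃ (q : β) (C : Set α), IsChain (· ≤ ·) C ∧ U = C ×ˢ ({q} : Set β))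

/-- A *semiantichain*: no two distinct elements lie in a common unichain. -/
def IsSemiantichain {α β : Type*} [PartialOrder α] [PartialOrder β] (S : Set (α × β)) : Prop :=
  ∀ x ∈ S, ∀ y ∈ S, x ≠ y → ∀ U : Set (α × β), IsUnichain U → ¬(x ∈ U ∧ y ∈ U)

/-- The maximum size of a semiantichain in `α × β`. -/
noncomputable def maxSemiantichain (α β : Type*) [PartialOrder α] [PartialOrder β] : ℕ :=
  sSup {n | ∃ S : Set (α × β), IsSemiantichain S ∧ S.ncard = n}

/-- The minimum number of unichains needed to cover `α × β`. -/
noncomputable def minUnichainCover (α β : Type*) [PartialOrder α] [PartialOrder β] : ℕ :=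
  sInf {n | ∃ U : Fin n → Set (α × β), (∀ i, IsUnichain (U i)) ∧ (⋃ i, U i) = Set.univ}

/-- The poset `P` on six elements. -/
def SWP : Type := Fin 6

/-- The poset `Q` on eight elements. -/
def SWQ : Type := Fin 8

instance : Fintype SWP := inferInstanceAs (Fintype (Fin 6))
instance : DecidableEq SWP := inferInstanceAs (DecidableEq (Fin 6))
instance : Fintype SWQ := inferInstanceAs (Fintype (Fin 8))
instance : DecidableEq SWQ := inferInstanceAs (DecidableEq (Fin 8))

/-- Principal down-sets of `P`. -/
def swDownP : Fin 6 → List (Fin 6) :=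
  ![[0], [1], [2], [3, 0], [4, 0], [5, 0, 1, 2]]

/-- Principal down-sets of `Q`. -/
def swDownQ : Fin 8 → List (Fin 8) :=
  ![[0], [1], [2], [3, 0], [4, 0], [5, 0, 1, 2], [6, 0, 1, 2, 3], [7, 0, 1, 2, 3, 4, 5]]

instance : PartialOrder SWP where
  le a b := List.elem (α := Fin 6) a (swDownP b) = true
  le_refl := by
    change ∀ a : Fin 6, List.elem a (swDownP a) = true
    decide +kernel
  le_trans := by
    change ∀ a b c : Fin 6, List.elem a (swDownP b) = true →
      List.elem b (swDownP c) = true → List.elem a (swDownP c) = true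
    decide +kernel
  le_antisymm := by
    change ∀ a b : Fin 6, List.elem a (swDownP b) = true →
      List.elem b (swDownP a) = true → a = b
    decide +kernel

instance : PartialOrder SWQ where
  le a b := List.elem (α := Fin 8) a (swDownQ b) = true
  le_refl := by
    change ∀ a : Fin 8, List.elem a (swDownQ a) = true
    decide +kernel
  le_trans := by
    change ∀ a b c : Fin 8, List.elem a (swDownQ b) = true →
      List.elem b (swDownQ c) = true → List.elem a (swDownQ c) = true
    decide +kernel
  le_antisymm := by
    change ∀ a b : Fin 8, List.elem a (swDownQ b) = true →
      List.elem b (swDownQ a) = true → a = b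
    decide +kernel

instance : DecidableLE SWP := fun a b =>
  inferInstanceAs (Decidable (List.elem (α := Fin 6) a (swDownP b) = true))
instance : DecidableLE SWQ := fun a b =>
  inferInstanceAs (Decidable (List.elem (α := Fin 8) a (swDownQ b) = true))

/-- Twice an optimal fractional semiantichain. -/
def swWeight (a : SWP) (b : SWQ) : ℕ :=
  (![![0, 0, 0, 0, 0, 0, 2, 2],
     ![0, 1, 1, 1, 2, 1, 1, 0],
     ![0, 1, 1, 1, 2, 1, 1, 0],
     ![0, 2, 2, 2, 2, 0, 0, 0],
     ![0, 2, 2, 2, 2, 0, 0, 0],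
     ![1, 1, 1, 1, 0, 1, 0, 0]] : Fin 6 → Fin 8 → ℕ) a b

/-- The unichains `{p} × C` of the double cover. -/
def swRows : List (Fin 6 × Finset (Fin 8)) :=
  [(0, {0, 3, 6}), (0, {0, 5, 7}), (0, {1, 5, 7}),
   (1, {0, 3, 6}), (1, {0, 3, 6}), (1, {1, 5, 7}), (1, {1, 5, 7}),
   (2, {0, 3, 6}), (2, {0, 4, 7}), (2, {0, 4, 7}), (2, {1, 6}), (2, {2, 5, 7}), (2, {2, 5, 7}),
   (3, {0, 3, 6}), (3, {0, 3, 6}), (3, {1, 5, 7}), (3, {1, 5, 7}),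
   (4, {0, 3, 6}), (4, {0, 4, 7}), (4, {1, 6}), (4, {2, 5, 7}), (4, {2, 5, 7}),
   (5, {0, 3, 6}), (5, {0, 5, 7}), (5, {1, 5, 7})]

/-- The unichains `C × {q}` of the double cover. -/
def swCols : List (Fin 8 × Finset (Fin 6)) :=
  [(1, {0, 4}), (1, {2, 5}), (2, {0, 3}), (2, {0, 3}), (2, {1, 5}), (2, {1, 5}),
   (3, {0, 4}), (3, {2, 5}), (4, {0, 3}), (4, {0, 3}), (4, {0, 4}), (4, {1, 5}), (4, {1, 5}),
   (6, {0, 5})]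

/-- The double cover: 39 unichains covering every element at least twice. -/
def swCover (i : Fin 39) : Finset (SWP × SWQ) :=
  if i.1 < 25 then
    (({(swRows.getD i.1 (0, ∅)).1} : Finset (Fin 6)) ×ˢ (swRows.getD i.1 (0, ∅)).2 :
      Finset (Fin 6 × Fin 8))
  else
    ((swCols.getD (i.1 - 25) (0, ∅)).2 ×ˢ
      ({(swCols.getD (i.1 - 25) (0, ∅)).1} : Finset (Fin 8)) : Finset (Fin 6 × Fin 8))

/-- Two elements lying in a common unichain. -/
def swAdj (x y : SWP × SWQ) : Prop :=
  (x.1 = y.1 ∧ (x.2 ≤ y.2 ∨ y.2 ≤ x.2)) ∨ (x.2 = y.2 ∧ (x.1 ≤ y.1 ∨ y.1 ≤ x.1))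

instance (x y : SWP × SWQ) : Decidable (swAdj x y) := by
  unfold swAdj; infer_instance

theorem swCover_adj : ∀ i : Fin 39, ∀ x ∈ swCover i, ∀ y ∈ swCover i, swAdj x y := by
  decide +kernel

theorem swCover_two : ∀ x : SWP × SWQ, 2 ≤ (Finset.univ.filter fun i => x ∈ swCover i).card := by
  decide +kernel

theorem swWeight_total : ∑ x : SWP × SWQ, swWeight x.1 x.2 = 39 := by
  decide +kernel

theorem swWeight_row : ∀ C : Finset SWQ, (∀ a ∈ C, ∀ b ∈ C, a ≤ b ∨ b ≤ a) →
    ∀ p : SWP, ∑ b ∈ C, swWeight p b ≤ 2 := by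
  decide +kernel

theorem swWeight_col : ∀ C : Finset SWP, (∀ a ∈ C, ∀ b ∈ C, a ≤ b ∨ b ≤ a) →
    ∀ q : SWQ, ∑ a ∈ C, swWeight a q ≤ 2 := by
  decide +kernel

theorem chain_total {α : Type*} [PartialOrder α] {C : Set α} (h : IsChain (· ≤ ·) C) {a b : α}
    (ha : a ∈ C) (hb : b ∈ C) : a ≤ b ∨ b ≤ a := by
  by_cases e : a = b
  · exact Or.inl e.le
  · exact h ha hb e

theorem chain_pair {α : Type*} [PartialOrder α] {a b : α} (h : a ≤ b ∨ b ≤ a) :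
    IsChain (· ≤ ·) ({a, b} : Set α) := by
  intro x hx y hy _
  simp only [Set.mem_insert_iff, Set.mem_singleton_iff] at hx hy
  rcases hx with rfl | rfl <;> rcases hy with rfl | rfl <;>
    first | exact Or.inl le_rfl | exact h | exact h.symm

theorem swAdj_unichain {x y : SWP × SWQ} (h : swAdj x y) :
    ∃ U : Set (SWP × SWQ), IsUnichain U ∧ x ∈ U ∧ y ∈ U := by
  obtain ⟨a, b⟩ := x
  obtain ⟨c, d⟩ := y
  rcases h with ⟨h1, h2⟩ | ⟨h1, h2⟩
  · simp only at h1 h2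
    subst h1
    exact ⟨{a} ×ˢ {b, d}, Or.inl ⟨a, _, chain_pair h2, rfl⟩, by simp, by simp⟩
  · simp only at h1 h2
    subst h1
    exact ⟨{a, c} ×ˢ {b}, Or.inr ⟨b, _, chain_pair h2, rfl⟩, by simp, by simp⟩

theorem sw_semiantichain_le (S : Set (SWP × SWQ)) (hS : IsSemiantichain S) : S.ncard ≤ 19 := by
  classical
  have hc : S.ncard = S.toFinset.card := Set.ncard_eq_toFinset_card' S
  have h1 : ∀ i : Fin 39, (S.toFinset.filter fun x => x ∈ swCover i).card ≤ 1 := by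
    intro i
    rw [Finset.card_le_one]
    intro x hx y hy
    simp only [Finset.mem_filter, Set.mem_toFinset] at hx hy
    by_contra hne
    obtain ⟨U, hU, hxy⟩ := swAdj_unichain (swCover_adj i x hx.2 y hy.2)
    exact hS x hx.1 y hy.1 hne U hU hxy
  have h2 : S.toFinset.card * 2 ≤ 39 := by
    calc S.toFinset.card * 2 = ∑ x ∈ S.toFinset, 2 := by simp
      _ ≤ ∑ x ∈ S.toFinset, (Finset.univ.filter fun i => x ∈ swCover i).card :=
          Finset.sum_le_sum fun x _ => swCover_two x
      _ = ∑ i : Fin 39, (S.toFinset.filter fun x => x ∈ swCover i).card :=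
          Finset.sum_card_bipartiteAbove_eq_sum_card_bipartiteBelow (fun x i => x ∈ swCover i)
      _ ≤ ∑ i : Fin 39, 1 := Finset.sum_le_sum fun i _ => h1 i
      _ = 39 := by simp
  omega

theorem sw_unichain_weight (U : Set (SWP × SWQ)) (hU : IsUnichain U)
    (T : Finset (SWP × SWQ)) (hT : ∀ x, x ∈ T ↔ x ∈ U) :
    ∑ x ∈ T, swWeight x.1 x.2 ≤ 2 := by
  classical
  rcases hU with ⟨p, C, hC, rfl⟩ | ⟨q, C, hC, rfl⟩
  · have : T = ({p} : Finset SWP) ×ˢ C.toFinset := by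
      ext x
      rw [hT, Finset.mem_product, Set.mem_prod, Finset.mem_singleton, Set.mem_singleton_iff,
        Set.mem_toFinset]
    rw [this, Finset.sum_product, Finset.sum_singleton]
    refine swWeight_row C.toFinset ?_ p
    intro a ha b hb
    exact chain_total hC (Set.mem_toFinset.1 ha) (Set.mem_toFinset.1 hb)
  · have : T = C.toFinset ×ˢ ({q} : Finset SWQ) := by
      ext x
      rw [hT, Finset.mem_product, Set.mem_prod, Finset.mem_singleton, Set.mem_singleton_iff,
        Set.mem_toFinset]
    rw [this, Finset.sum_product_right, Finset.sum_singleton]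
    refine swWeight_col C.toFinset ?_ q
    intro a ha b hb
    exact chain_total hC (Set.mem_toFinset.1 ha) (Set.mem_toFinset.1 hb)

theorem sw_cover_ge (n : ℕ) (U : Fin n → Set (SWP × SWQ)) (hU : ∀ i, IsUnichain (U i))
    (hcov : (⋃ i, U i) = Set.univ) : 20 ≤ n := by
  classical
  have h : 39 ≤ n * 2 := by
    calc 39 = ∑ x : SWP × SWQ, swWeight x.1 x.2 := swWeight_total.symm
      _ ≤ ∑ x : SWP × SWQ, ∑ i : Fin n, if x ∈ (U i).toFinset then swWeight x.1 x.2 else 0 := by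
          refine Finset.sum_le_sum fun x _ => ?_
          have hx : x ∈ ⋃ i, U i := by rw [hcov]; trivial
          obtain ⟨i, hi⟩ := Set.mem_iUnion.1 hx
          have := Finset.single_le_sum
            (f := fun i => if x ∈ (U i).toFinset then swWeight x.1 x.2 else 0)
            (fun _ _ => Nat.zero_le _) (Finset.mem_univ i)
          simpa [hi] using this
      _ = ∑ i : Fin n, ∑ x ∈ (U i).toFinset, swWeight x.1 x.2 := by
          rw [Finset.sum_comm]
          refine Finset.sum_congr rfl fun i _ => ?_
          rw [← Finset.sum_filter, Finset.filter_univ_mem]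
      _ ≤ ∑ i : Fin n, 2 := Finset.sum_le_sum fun i _ =>
          sw_unichain_weight (U i) (hU i) _ fun _ => Set.mem_toFinset
      _ = n * 2 := by simp
  omega

theorem sw_cover_exists : {n | ∃ U : Fin n → Set (SWP × SWQ),
    (∀ i, IsUnichain (U i)) ∧ (⋃ i, U i) = Set.univ}.Nonempty := by
  refine ⟨Fintype.card (SWP × SWQ), fun i => {(Fintype.equivFin _).symm i}, fun i => ?_, ?_⟩
  · refine Or.inl ⟨((Fintype.equivFin (SWP × SWQ)).symm i).1,
      {((Fintype.equivFin (SWP × SWQ)).symm i).2}, by simp, by simp⟩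
  · ext x
    simp only [Set.mem_iUnion, Set.mem_singleton_iff, Set.mem_univ, iff_true]
    exact ⟨Fintype.equivFin _ x, by simp⟩

/-- There exist finite posets `P` and `Q` such that the maximum size of a
semiantichain in `P × Q` is strictly smaller than the minimum number of
unichains needed to cover `P × Q` (disproving the Saks–West conjecture). -/
theorem saks_west_conjecture_false :
    ∃ (α β : Type) (ia : PartialOrder α) (ib : PartialOrder β)
      (_ : Fintype α) (_ : Fintype β),
      @maxSemiantichain α β ia ib < @minUnichainCover α β ia ib := by
  refine ⟨SWP, SWQ, inferInstance, inferInstance, inferInstance, inferInstance, ?_⟩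
  have h1 : maxSemiantichain SWP SWQ ≤ 19 := by
    apply csSup_le'
    rintro n ⟨S, hS, rfl⟩
    exact sw_semiantichain_le S hS
  have h2 : 20 ≤ minUnichainCover SWP SWQ := by
    obtain ⟨U, hU, hc⟩ := Nat.sInf_mem sw_cover_exists
    exact sw_cover_ge _ U hU hc
  omega
end

section
/- For every positive integer k there exist finite posets P and Q such that the minimum number of unichains needed to cover the product poset P×Q exceeds the maximum size of a semiantichain in P×Q by at least k. -/
/-! The poset `V` (one minimum below two incomparable elements), in `K` disjoint copies, times a
nine element poset `NQ`.  The LP relaxation has value `25/2` on every copy, while semiantichains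
have at most `12` elements per copy. -/

/-- Strict relation of the nine element poset. -/
def nqLt (a b : Fin 9) : Bool :=
  (a, b) ∈ ([(0,3),(1,3),(1,5),(1,6),(1,7),(2,3),(2,7),(4,6),(4,7),(4,8),(5,7)] :
    List (Fin 9 × Fin 9))

/-- The nine element poset. -/
def NQ : Type := Fin 9

instance : Fintype NQ := inferInstanceAs (Fintype (Fin 9))
instance : DecidableEq NQ := inferInstanceAs (DecidableEq (Fin 9))

instance : PartialOrder NQ where
  le a b := (a : Fin 9) = b ∨ nqLt a b = true
  le_refl a := Or.inl rfl
  le_trans := by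
    have h : ∀ a b c : Fin 9, (a = b ∨ nqLt a b = true) → (b = c ∨ nqLt b c = true) →
      (a = c ∨ nqLt a c = true) := by decide
    exact h
  le_antisymm := by
    have h : ∀ a b : Fin 9, (a = b ∨ nqLt a b = true) → (b = a ∨ nqLt b a = true) →
      a = b := by decide
    exact h

/-- `K` disjoint copies of the poset `V`. -/
def VK (K : ℕ) : Type := Fin K × Fin 3

instance (K : ℕ) : Fintype (VK K) := inferInstanceAs (Fintype (Fin K × Fin 3))
instance (K : ℕ) : DecidableEq (VK K) := inferInstanceAs (DecidableEq (Fin K × Fin 3))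

instance (K : ℕ) : PartialOrder (VK K) where
  le x y := x.1 = y.1 ∧ (x.2 = y.2 ∨ x.2 = 0)
  le_refl x := ⟨rfl, Or.inl rfl⟩
  le_trans := by
    rintro ⟨i, a⟩ ⟨j, b⟩ ⟨l, c⟩ ⟨h1, h2⟩ ⟨h3, h4⟩
    refine ⟨h1.trans h3, ?_⟩
    dsimp only at *
    rcases h2 with h2 | h2
    · rw [h2]; exact h4
    · exact Or.inr h2
  le_antisymm := by
    rintro ⟨i, a⟩ ⟨j, b⟩ ⟨h1, h2⟩ ⟨h3, h4⟩
    dsimp only at *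
    have : a = b := by
      rcases h2 with h2 | h2
      · exact h2
      · rcases h4 with h4 | h4
        · exact h4.symm
        · rw [h2, h4]
    rw [h1, this]

/-- A vertex of the product. -/
def vx {K : ℕ} (i : Fin K) (a : Fin 3) (q : Fin 9) : VK K × NQ := ((i, a), q)

lemma sum_vx {K : ℕ} (g : VK K × NQ → ℕ) :
    ∑ x, g x = ∑ i : Fin K, ∑ a : Fin 3, ∑ q : Fin 9, g (vx i a q) := by
  rw [Fintype.sum_prod_type]
  exact Fintype.sum_prod_type (fun p : Fin K × Fin 3 => ∑ q : Fin 9, g (p, q))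

lemma row_bound (a b : Fin 9 → ℕ) (hab : ∀ q, a q + b q ≤ 1)
    (ha : ∀ q r, nqLt q r = true → a q + a r ≤ 1)
    (hb : ∀ q r, nqLt q r = true → b q + b r ≤ 1) :
    ∑ q, a q + 2 * ∑ q, b q ≤ 12 := by
  have h0 := hab 0
  have h1 := hab 1
  have h2 := hab 2
  have h3 := hab 3
  have h4 := hab 4
  have h5 := hab 5
  have h6 := hab 6
  have h7 := hab 7
  have h8 := hab 8
  have a03 := ha 0 3 (by decide)
  have a13 := ha 1 3 (by decide)
  have a15 := ha 1 5 (by decide)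
  have a16 := ha 1 6 (by decide)
  have a17 := ha 1 7 (by decide)
  have a23 := ha 2 3 (by decide)
  have a27 := ha 2 7 (by decide)
  have a46 := ha 4 6 (by decide)
  have a47 := ha 4 7 (by decide)
  have a48 := ha 4 8 (by decide)
  have a57 := ha 5 7 (by decide)
  have b03 := hb 0 3 (by decide)
  have b13 := hb 1 3 (by decide)
  have b15 := hb 1 5 (by decide)
  have b16 := hb 1 6 (by decide)
  have b17 := hb 1 7 (by decide)
  have b23 := hb 2 3 (by decide)
  have b27 := hb 2 7 (by decide)
  have b46 := hb 4 6 (by decide)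
  have b47 := hb 4 7 (by decide)
  have b48 := hb 4 8 (by decide)
  have b57 := hb 5 7 (by decide)
  have ta : a 1 + a 5 + a 7 ≤ 1 := by omega
  have tb : b 1 + b 5 + b 7 ≤ 1 := by omega
  simp only [Fin.sum_univ_succ, Fin.sum_univ_zero, Fin.isValue]
  simp only [Fin.succ_zero_eq_one, Fin.succ_one_eq_two, Fin.reduceSucc, Fin.isValue]
  by_contra hcon
  have hcon' := not_le.mp hcon
  have hcon2 : 13 ≤ _ := hcon'
  clear hcon hcon'
  linarith

lemma semi_pair {α β : Type*} [PartialOrder α] [PartialOrder β] {S : Set (α × β)}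
    (hS : IsSemiantichain S) {x y : α × β} (hx : x ∈ S) (hy : y ∈ S) (hne : x ≠ y) :
    ¬ (x.1 = y.1 ∧ x.2 ≤ y.2) ∧ ¬ (x.2 = y.2 ∧ x.1 ≤ y.1) := by
  obtain ⟨p, q⟩ := x
  obtain ⟨p', q'⟩ := y
  constructor
  · rintro ⟨h1, h2⟩
    dsimp only at h1 h2
    subst h1
    refine hS _ hx _ hy hne ({p} ×ˢ {q, q'}) (Or.inl ⟨p, {q, q'}, IsChain.pair h2, rfl⟩) ?_
    simp
  · rintro ⟨h1, h2⟩
    dsimp only at h1 h2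
    subst h1
    refine hS _ hx _ hy hne ({p, p'} ×ˢ {q}) (Or.inr ⟨q, {p, p'}, IsChain.pair h2, rfl⟩) ?_
    simp

lemma semi_bound (K : ℕ) (S : Set (VK K × NQ)) (hS : IsSemiantichain S) :
    S.ncard ≤ 12 * K := by
  classical
  let g : VK K × NQ → ℕ := fun x => if x ∈ S then 1 else 0
  have hcard : S.ncard = ∑ x, g x := by
    rw [Set.ncard_eq_toFinset_card', Finset.card_eq_sum_ones]
    simp only [g, Finset.sum_ite, Finset.sum_const_zero, add_zero]
    refine Finset.sum_congr ?_ (fun _ _ => rfl)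
    ext x; simp
  rw [hcard, sum_vx]
  have hle : ∀ x y : VK K × NQ, x ≠ y → ((x.1 = y.1 ∧ x.2 ≤ y.2) ∨ (x.2 = y.2 ∧ x.1 ≤ y.1)) →
      g x + g y ≤ 1 := by
    intro x y hne h
    by_cases hx : x ∈ S
    · by_cases hy : y ∈ S
      · have := semi_pair hS hx hy hne
        tauto
      · simp [g, hx, hy]
    · by_cases hy : y ∈ S <;> simp [g, hx, hy]
  have hrow : ∀ (i : Fin K) (a : Fin 3) (q r : Fin 9), nqLt q r = true →
      g (vx i a q) + g (vx i a r) ≤ 1 := by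
    intro i a q r h
    refine hle _ _ ?_ (Or.inl ⟨rfl, Or.inr h⟩)
    intro he
    have he2 : q = r := congrArg Prod.snd he
    subst he2
    have hirr : ∀ q : Fin 9, ¬ nqLt q q = true := by decide
    exact hirr q h
  have hcol : ∀ (i : Fin K) (a : Fin 3) (q : Fin 9), a ≠ 0 →
      g (vx i 0 q) + g (vx i a q) ≤ 1 := by
    intro i a q h
    refine hle _ _ ?_ (Or.inr ⟨rfl, rfl, Or.inr rfl⟩)
    intro he
    have he1 : ((i, 0) : Fin K × Fin 3) = (i, a) := congrArg Prod.fst he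
    exact h (congrArg Prod.snd he1).symm
  have hi : ∀ i : Fin K, ∑ a : Fin 3, ∑ q : Fin 9, g (vx i a q) ≤ 12 := by
    intro i
    have h1 := row_bound (fun q => g (vx i 0 q)) (fun q => g (vx i 1 q))
      (fun q => hcol i 1 q (by decide)) (hrow i 0) (hrow i 1)
    have h2 := row_bound (fun q => g (vx i 0 q)) (fun q => g (vx i 2 q))
      (fun q => hcol i 2 q (by decide)) (hrow i 0) (hrow i 2)
    rw [Fin.sum_univ_three]
    omega
  calc _ ≤ ∑ i : Fin K, 12 := Finset.sum_le_sum (fun i _ => hi i)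
    _ = 12 * K := by simp [mul_comm]

/-- Doubled fractional weights. -/
def wt (a : Fin 3) (q : Fin 9) : ℕ :=
  if a = 0 then ![1,1,1,1,2,1,0,0,0] q else ![1,0,1,1,0,1,2,1,2] q

/-- A chain meets an antichain at most once, so sums of two antichain indicators weigh at most 2. -/
lemma chain_weight {α : Type*} [PartialOrder α] [DecidableEq α] (C : Finset α)
    (hC : IsChain (· ≤ ·) (C : Set α)) (w : α → ℕ) (p1 p2 : α → Bool)
    (hw : ∀ x, w x ≤ (if p1 x then 1 else 0) + (if p2 x then 1 else 0))
    (h1 : ∀ x y, p1 x → p1 y → x ≤ y → x = y)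
    (h2 : ∀ x y, p2 x → p2 y → x ≤ y → x = y) : ∑ x ∈ C, w x ≤ 2 := by
  have key : ∀ (p : α → Bool), (∀ x y, p x → p y → x ≤ y → x = y) →
      ∑ x ∈ C, (if p x then 1 else 0) ≤ 1 := by
    intro p h
    rw [Finset.sum_boole]
    simp only [Nat.cast_id]
    rw [Finset.card_le_one]
    intro x hx y hy
    rw [Finset.mem_filter] at hx hy
    rcases hC.total hx.1 hy.1 with hxy | hxy
    · exact h x y hx.2 hy.2 hxy
    · exact (h y x hy.2 hx.2 hxy).symm
  calc _ ≤ ∑ x ∈ C, ((if p1 x then 1 else 0) + (if p2 x then 1 else 0)) :=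
        Finset.sum_le_sum (fun x _ => hw x)
    _ ≤ 1 + 1 := by
        rw [Finset.sum_add_distrib]
        exact add_le_add (key p1 h1) (key p2 h2)

/-- Boolean list membership. -/
def inL (q : Fin 9) (l : List (Fin 9)) : Bool := decide (q ∈ l)

lemma row_weight (a : Fin 3) (C : Finset NQ) (hC : IsChain (· ≤ ·) (C : Set NQ)) :
    ∑ q ∈ C, wt a q ≤ 2 := by
  by_cases ha : a = 0
  · subst ha
    refine chain_weight (α := NQ) C hC _ (fun q : Fin 9 => inL q [0,1,2,4])
      (fun q : Fin 9 => inL q [3,4,5]) ?_ ?_ ?_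
    · have h : ∀ x : Fin 9, wt 0 x ≤ (if inL x [0,1,2,4] then 1 else 0) +
        (if inL x [3,4,5] then 1 else 0) := by decide
      exact h
    · have h : ∀ x y : Fin 9, inL x [0,1,2,4] → inL y [0,1,2,4] →
        (x = y ∨ nqLt x y = true) → x = y := by decide
      exact h
    · have h : ∀ x y : Fin 9, inL x [3,4,5] → inL y [3,4,5] →
        (x = y ∨ nqLt x y = true) → x = y := by decide
      exact h
  · refine chain_weight (α := NQ) C hC _ (fun q : Fin 9 => inL q [0,2,5,6,8])
      (fun q : Fin 9 => inL q [3,6,7,8]) ?_ ?_ ?_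
    · have h : ∀ a : Fin 3, a ≠ 0 → ∀ x : Fin 9,
        wt a x ≤ (if inL x [0,2,5,6,8] then 1 else 0) +
        (if inL x [3,6,7,8] then 1 else 0) := by decide
      exact h a ha
    · have h : ∀ x y : Fin 9, inL x [0,2,5,6,8] →
        inL y [0,2,5,6,8] →
        (x = y ∨ nqLt x y = true) → x = y := by decide
      exact h
    · have h : ∀ x y : Fin 9, inL x [3,6,7,8] →
        inL y [3,6,7,8] →
        (x = y ∨ nqLt x y = true) → x = y := by decide
      exact h

lemma vk_bot {K : ℕ} (x y : VK K) (_hx : decide (x.2 = 0) = true) (hy : decide (y.2 = 0) = true)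
    (h : x ≤ y) : x = y :=
  le_antisymm h ⟨h.1.symm, Or.inr (of_decide_eq_true hy)⟩

lemma vk_top {K : ℕ} (x y : VK K) (hx : decide (x.2 ≠ 0) = true) (_hy : decide (y.2 ≠ 0) = true)
    (h : x ≤ y) : x = y :=
  le_antisymm h ⟨h.1.symm, Or.inl ((h.2.resolve_right (of_decide_eq_true hx)).symm)⟩

lemma col_weight {K : ℕ} (q : Fin 9) (C : Finset (VK K))
    (hC : IsChain (· ≤ ·) (C : Set (VK K))) : ∑ p ∈ C, wt p.2 q ≤ 2 := by
  by_cases h4 : q = 4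
  · refine chain_weight C hC _ (fun p => decide (p.2 = 0)) (fun p => decide (p.2 = 0)) ?_ vk_bot vk_bot
    have h : ∀ a : Fin 3, wt a 4 ≤ (if decide (a = 0) = true then 1 else 0) + (if decide (a = 0) = true then 1 else 0) := by
      decide
    intro x
    rw [h4]
    exact h x.2
  · by_cases h6 : q = 6 ∨ q = 8
    · refine chain_weight C hC _ (fun p => decide (p.2 ≠ 0)) (fun p => decide (p.2 ≠ 0)) ?_ vk_top vk_top
      have h : ∀ q : Fin 9, (q = 6 ∨ q = 8) → ∀ a : Fin 3,
          wt a q ≤ (if decide (a ≠ 0) = true then 1 else 0) + (if decide (a ≠ 0) = true then 1 else 0) := by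
        decide
      intro x
      exact h q h6 x.2
    · refine chain_weight C hC _ (fun p => decide (p.2 = 0)) (fun p => decide (p.2 ≠ 0)) ?_ vk_bot vk_top
      have h : ∀ q : Fin 9, q ≠ 4 → ¬ (q = 6 ∨ q = 8) → ∀ a : Fin 3,
          wt a q ≤ (if decide (a = 0) = true then 1 else 0) + (if decide (a ≠ 0) = true then 1 else 0) := by
        decide
      intro x
      exact h q h4 h6 x.2

/-- The weight on the product. -/
def ww {K : ℕ} (p : VK K) (q : NQ) : ℕ := wt (Prod.snd (α := Fin K) (β := Fin 3) p) q

open Classical in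
lemma unichain_weight {K : ℕ} (U : Set (VK K × NQ)) (hU : IsUnichain U) :
    ∑ x : VK K × NQ, (if x ∈ U then ww x.1 x.2 else 0) ≤ 2 := by
  rw [← Finset.sum_filter]
  rcases hU with ⟨p, C, hC, hUC⟩ | ⟨q, C, hC, hUC⟩
  · have : (Finset.univ.filter (· ∈ U)) =
        ({p} : Finset (VK K)) ×ˢ (Finset.univ.filter (· ∈ C)) := by
      ext x; simp only [hUC, Finset.mem_filter, Finset.mem_univ, true_and, Finset.mem_product, Set.mem_prod, Set.mem_singleton_iff, Finset.mem_singleton]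
    rw [this, Finset.sum_product, Finset.sum_singleton]
    exact row_weight (Prod.snd (α := Fin K) (β := Fin 3) p) (Finset.univ.filter (· ∈ C)) (by simpa using hC)
  · have : (Finset.univ.filter (· ∈ U)) =
        (Finset.univ.filter (· ∈ C)) ×ˢ ({q} : Finset NQ) := by
      ext x; simp only [hUC, Finset.mem_filter, Finset.mem_univ, true_and, Finset.mem_product, Set.mem_prod, Set.mem_singleton_iff, Finset.mem_singleton]
    rw [this, Finset.sum_product]
    simp only [Finset.sum_singleton]
    exact col_weight q _ (by simpa using hC)

lemma cover_bound (K n : ℕ) (U : Fin n → Set (VK K × NQ)) (hU : ∀ i, IsUnichain (U i))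
    (hcov : (⋃ i, U i) = Set.univ) : 25 * K ≤ 2 * n := by
  classical
  have htot : ∑ x : VK K × NQ, ww x.1 x.2 = 25 * K := by
    rw [sum_vx]
    have h : ∑ a : Fin 3, ∑ q : Fin 9, wt a q = 25 := by decide
    calc _ = ∑ i : Fin K, 25 := Finset.sum_congr rfl (fun i _ => h)
      _ = 25 * K := by simp [mul_comm]
  rw [← htot]
  calc _ ≤ ∑ x : VK K × NQ, ∑ i : Fin n, (if x ∈ U i then ww x.1 x.2 else 0) := by
        refine Finset.sum_le_sum (fun x _ => ?_)
        have hx : x ∈ ⋃ i, U i := by rw [hcov]; trivial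
        obtain ⟨i, hi⟩ := Set.mem_iUnion.mp hx
        have := Finset.single_le_sum (f := fun i => if x ∈ U i then ww x.1 x.2 else 0)
          (fun _ _ => Nat.zero_le _) (Finset.mem_univ i)
        simpa only [hi, if_true] using this
    _ = ∑ i : Fin n, ∑ x : VK K × NQ, (if x ∈ U i then ww x.1 x.2 else 0) := Finset.sum_comm
    _ ≤ ∑ i : Fin n, 2 := Finset.sum_le_sum (fun i _ => by
        convert unichain_weight (U i) (hU i))
    _ = 2 * n := by simp [mul_comm]

lemma cover_nonempty (K : ℕ) : {n | ∃ U : Fin n → Set (VK K × NQ),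
    (∀ i, IsUnichain (U i)) ∧ (⋃ i, U i) = Set.univ}.Nonempty := by
  refine ⟨Fintype.card (VK K × NQ), fun i => {(Fintype.equivFin _).symm i}, ?_, ?_⟩
  · intro i
    refine Or.inl ⟨((Fintype.equivFin (VK K × NQ)).symm i).1,
      {((Fintype.equivFin (VK K × NQ)).symm i).2}, Set.pairwise_singleton _ _, ?_⟩
    simp
  · ext x
    simp only [Set.mem_iUnion, Set.mem_singleton_iff, Set.mem_univ, iff_true]
    exact ⟨Fintype.equivFin _ x, by simp⟩

/-- For every positive integer `k` there exist finite posets `P`, `Q` such that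
the minimum number of unichains needed to cover `P × Q` exceeds the maximum
size of a semiantichain in `P × Q` by at least `k`. -/
theorem saks_west_gap_arbitrarily_large :
    ∀ k : ℕ, 0 < k →
      ∃ (α β : Type) (ia : PartialOrder α) (ib : PartialOrder β)
        (_ : Fintype α) (_ : Fintype β),
        @maxSemiantichain α β ia ib + k ≤ @minUnichainCover α β ia ib := by
  intro k _
  refine ⟨VK (2 * k), NQ, inferInstance, inferInstance, inferInstance, inferInstance, ?_⟩
  have h1 : maxSemiantichain (VK (2 * k)) NQ ≤ 12 * (2 * k) := by
    refine csSup_le' ?_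
    rintro n ⟨S, hS, rfl⟩
    exact semi_bound _ S hS
  have h2 : 25 * (2 * k) ≤ 2 * minUnichainCover (VK (2 * k)) NQ := by
    obtain ⟨U, hU, hc⟩ := Nat.sInf_mem (cover_nonempty (2 * k))
    exact cover_bound _ _ U hU hc
  omega
end

section
/- If a finite poset P is both d-decomposable and c-decomposable and a finite poset Q is d-decomposable, then the maximum size of a semiantichain in P×Q equals the minimum number of unichains needed to cover P×Q, and this common value equals ∑_{i=1}^{min(h(P),h(Q))} μ_i^P·μ_i^Q = ∑_{j=1}^{w(P)} d_{λ_j^P}(Q). -/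
/-- Height: maximum size of a chain. -/
noncomputable def heightP (α : Type*) [PartialOrder α] : ℕ :=
  sSup {n | ∃ C : Set α, IsChain (· ≤ ·) C ∧ C.ncard = n}

/-- Width: maximum size of an antichain. -/
noncomputable def widthP (α : Type*) [PartialOrder α] : ℕ :=
  sSup {n | ∃ A : Set α, IsAntichain (· ≤ ·) A ∧ A.ncard = n}

/-- `dk α k`: maximum size of a union of `k` antichains. -/
noncomputable def dk (α : Type*) [PartialOrder α] (k : ℕ) : ℕ :=
  sSup {n | ∃ A : Fin k → Set α, (∀ i, IsAntichain (· ≤ ·) (A i)) ∧ (⋃ i, A i).ncard = n}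

/-- `ck α k`: maximum size of a union of `k` chains. -/
noncomputable def ck (α : Type*) [PartialOrder α] (k : ℕ) : ℕ :=
  sSup {n | ∃ C : Fin k → Set α, (∀ i, IsChain (· ≤ ·) (C i)) ∧ (⋃ i, C i).ncard = n}

/-- `P` is d-decomposable: it has an antichain partition `A_1, …, A_{h(P)}`
with `|A_1 ∪ … ∪ A_k| = d_k(P)` for every `k ≤ h(P)`. -/
def DDecomposable (α : Type*) [PartialOrder α] : Prop :=
  ∃ A : Fin (heightP α) → Set α,
    (∀ i, IsAntichain (· ≤ ·) (A i)) ∧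
    (∀ i j, i ≠ j → Disjoint (A i) (A j)) ∧
    (⋃ i, A i) = Set.univ ∧
    ∀ k, k ≤ heightP α →
      (⋃ i : Fin (heightP α), ⋃ (_ : (i : ℕ) < k), A i).ncard = dk α k

/-- `P` is c-decomposable: it has a chain partition `C_1, …, C_{w(P)}`
with `|C_1 ∪ … ∪ C_k| = c_k(P)` for every `k ≤ w(P)`. -/
def CDecomposable (α : Type*) [PartialOrder α] : Prop :=
  ∃ C : Fin (widthP α) → Set α,
    (∀ i, IsChain (· ≤ ·) (C i)) ∧
    (∀ i j, i ≠ j → Disjoint (C i) (C j)) ∧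
    (⋃ i, C i) = Set.univ ∧
    ∀ k, k ≤ widthP α →
      (⋃ i : Fin (widthP α), ⋃ (_ : (i : ℕ) < k), C i).ncard = ck α k

section Helpers

open Classical in
/-- Repackaging of a decomposition by finsets indexed by the natural numbers. -/
lemma decomp_aux {α : Type} [Fintype α] {n : ℕ} (A : Fin n → Set α) (f : ℕ → ℕ)
    (hd : ∀ i j, i ≠ j → Disjoint (A i) (A j)) (hc : (⋃ i, A i) = Set.univ)
    (hf : ∀ k, k ≤ n → (⋃ i : Fin n, ⋃ (_ : (i : ℕ) < k), A i).ncard = f k) :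
    ∃ B : ℕ → Finset α, (∀ i, B i = ∅ ∨ ∃ j, (B i : Set α) = A j) ∧
      (∀ i j, i ≠ j → Disjoint (B i) (B j)) ∧ (∀ x, ∃ i < n, x ∈ B i) ∧
      (∀ i < n, f (i + 1) = f i + (B i).card) ∧ f n = Fintype.card α ∧ f 0 = 0 := by
  refine ⟨fun i => if h : i < n then (A ⟨i, h⟩).toFinset else ∅, ?_, ?_, ?_, ?_, ?_, ?_⟩
  · intro i
    by_cases h : i < n
    · right; exact ⟨⟨i, h⟩, by simp [h]⟩
    · left; simp [h]
  · intro i j hij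
    by_cases h : i < n
    · by_cases h' : j < n
      · simp only [h, h', dif_pos]
        rw [Set.disjoint_toFinset]
        exact hd _ _ (by simpa using hij)
      · simp [h']
    · simp [h]
  · intro x
    have : x ∈ ⋃ i, A i := by rw [hc]; trivial
    obtain ⟨i, hi⟩ := Set.mem_iUnion.1 this
    exact ⟨i, i.2, by simp [hi]⟩
  · intro i hi
    rw [← hf i hi.le, ← hf (i+1) hi]
    have : (⋃ j : Fin n, ⋃ (_ : (j : ℕ) < i + 1), A j) =
        (⋃ j : Fin n, ⋃ (_ : (j : ℕ) < i), A j) ∪ A ⟨i, hi⟩ := by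
      ext x
      simp only [Set.mem_iUnion, Set.mem_union, exists_prop]
      constructor
      · rintro ⟨j, hj, hx⟩
        rcases Nat.lt_succ_iff_lt_or_eq.1 hj with h | h
        · exact Or.inl ⟨j, h, hx⟩
        · right
          have : j = ⟨i, hi⟩ := Fin.ext h
          rwa [← this]
      · rintro (⟨j, hj, hx⟩ | hx)
        · exact ⟨j, by omega, hx⟩
        · exact ⟨_, by simp, hx⟩
    rw [this, Set.ncard_union_eq _ (Set.toFinite _) (Set.toFinite _)]
    · simp [hi, Set.ncard_eq_toFinset_card']
    · simp only [Set.disjoint_iUnion_left]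
      intro j hj
      exact hd _ _ (by rintro rfl; simp at hj)
  · rw [← hf n le_rfl]
    have : (⋃ j : Fin n, ⋃ (_ : (j : ℕ) < n), A j) = Set.univ := by
      rw [← hc]; simp
    rw [this, Set.ncard_univ, Nat.card_eq_fintype_card]
  · rw [← hf 0 (Nat.zero_le _)]; simp

lemma dk_bdd (α : Type) [Fintype α] [PartialOrder α] (k : ℕ) :
    BddAbove {n | ∃ A : Fin k → Set α, (∀ i, IsAntichain (· ≤ ·) (A i)) ∧ (⋃ i, A i).ncard = n} := by
  refine ⟨Nat.card α, ?_⟩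
  rintro n ⟨A, -, rfl⟩
  exact Set.ncard_le_card _

lemma le_dk {α : Type} [Fintype α] [PartialOrder α] {k : ℕ} (A : Fin k → Set α)
    (hA : ∀ i, IsAntichain (· ≤ ·) (A i)) : (⋃ i, A i).ncard ≤ dk α k :=
  le_csSup (dk_bdd α k) ⟨A, hA, rfl⟩

lemma exists_dk (α : Type) [Fintype α] [PartialOrder α] (k : ℕ) :
    ∃ A : Fin k → Set α, (∀ i, IsAntichain (· ≤ ·) (A i)) ∧ (⋃ i, A i).ncard = dk α k :=
  Nat.sSup_mem (s := {n | ∃ A : Fin k → Set α,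
    (∀ i, IsAntichain (· ≤ ·) (A i)) ∧ (⋃ i, A i).ncard = n})
    ⟨_, fun _ => ∅, by simp, rfl⟩ (dk_bdd α k)

lemma ck_bdd (α : Type) [Fintype α] [PartialOrder α] (k : ℕ) :
    BddAbove {n | ∃ A : Fin k → Set α, (∀ i, IsChain (· ≤ ·) (A i)) ∧ (⋃ i, A i).ncard = n} := by
  refine ⟨Nat.card α, ?_⟩
  rintro n ⟨A, -, rfl⟩
  exact Set.ncard_le_card _

lemma le_ck {α : Type} [Fintype α] [PartialOrder α] {k : ℕ} (A : Fin k → Set α)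
    (hA : ∀ i, IsChain (· ≤ ·) (A i)) : (⋃ i, A i).ncard ≤ ck α k :=
  le_csSup (ck_bdd α k) ⟨A, hA, rfl⟩

lemma dk_le_card (α : Type) [Fintype α] [PartialOrder α] (k : ℕ) : dk α k ≤ Fintype.card α := by
  obtain ⟨A, -, h⟩ := exists_dk α k
  rw [← h, ← Nat.card_eq_fintype_card]; exact Set.ncard_le_card _

lemma dk_mono (α : Type) [Fintype α] [PartialOrder α] : Monotone (dk α) := by
  refine monotone_nat_of_le_succ fun k => ?_
  obtain ⟨A, hA, h⟩ := exists_dk α k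
  rw [← h]
  let A' : Fin (k + 1) → Set α := fun i => if h : (i : ℕ) < k then A ⟨i, h⟩ else ∅
  refine le_trans (Set.ncard_le_ncard ?_ (Set.toFinite _)) (le_dk A' ?_)
  · refine Set.iUnion_subset fun i => ?_
    refine Set.Subset.trans ?_ (Set.subset_iUnion A' ⟨i, by omega⟩)
    simp [A']
  · intro i
    by_cases h : (i : ℕ) < k
    · simp only [A', h, dif_pos]; exact hA _
    · simp [A', h]

lemma dk_zero (α : Type) [Fintype α] [PartialOrder α] : dk α 0 = 0 := by
  obtain ⟨A, -, h⟩ := exists_dk α 0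
  rw [← h]; simp

open Classical in
/-- Egervary's theorem (perfect matching form). -/
lemma egervary {ι : Type} [Fintype ι] (w : ι → ι → ℤ) :
    ∃ (u v : ι → ℤ) (σ : ι ≃ ι), (∀ p q, w p q ≤ u p + v q) ∧ ∀ p, w p (σ p) = u p + v (σ p) := by
  have key : ∃ u v : ι → ℤ, (∀ p q, w p q ≤ u p + v q) ∧
      ∀ u' v' : ι → ℤ, (∀ p q, w p q ≤ u' p + v' q) → ∑ p, u p + ∑ p, v p ≤ ∑ p, u' p + ∑ p, v' p := by
    let T : Set ℕ := {n | ∃ u v : ι → ℤ, (∀ p q, w p q ≤ u p + v q) ∧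
      (∑ p, u p + ∑ p, v p - ∑ p, w p p) = n}
    have nn : ∀ u v : ι → ℤ, (∀ p q, w p q ≤ u p + v q) → 0 ≤ ∑ p, u p + ∑ p, v p - ∑ p, w p p := by
      intro u v h
      rw [← Finset.sum_add_distrib]
      have := Finset.sum_le_sum (s := Finset.univ) fun p _ => h p p
      linarith
    have hT : T.Nonempty := by
      let u : ι → ℤ := fun p => ∑ q, |w p q|
      have hu : ∀ p q, w p q ≤ u p + (0 : ι → ℤ) q := by
        intro p q
        have := Finset.single_le_sum (f := fun q => |w p q|) (fun q _ => abs_nonneg _) (Finset.mem_univ q)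
        have h2 := le_abs_self (w p q)
        simp only [Pi.zero_apply, u]
        linarith
      exact ⟨_, u, 0, hu, (Int.toNat_of_nonneg (nn u 0 hu)).symm⟩
    obtain ⟨u, v, h, hs⟩ := Nat.sInf_mem hT
    refine ⟨u, v, h, fun u' v' h' => ?_⟩
    have := Nat.sInf_le (s := T) ⟨u', v', h', (Int.toNat_of_nonneg (nn u' v' h')).symm⟩
    have h3 := Int.toNat_of_nonneg (nn u' v' h')
    omega
  obtain ⟨u, v, h, hmin⟩ := key
  let t : ι → Finset ι := fun p => Finset.univ.filter fun q => w p q = u p + v q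
  have hall : ∀ s : Finset ι, s.card ≤ (s.biUnion t).card := by
    intro s
    by_contra hlt
    push Not at hlt
    have := hmin (fun p => u p - if p ∈ s then 1 else 0)
      (fun q => v q + if q ∈ s.biUnion t then 1 else 0) (by
        intro p q
        have h1 := h p q
        by_cases hp : p ∈ s
        · by_cases hq : q ∈ s.biUnion t
          · simp only [hp, hq, if_true]; linarith
          · have : w p q ≠ u p + v q := fun he => hq (Finset.mem_biUnion.2 ⟨p, hp, by simp [t, he]⟩)
            simp only [hp, hq, if_true, if_false]; omega
        · simp only [hp, if_false]
          split_ifs <;> linarith)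
    rw [Finset.sum_sub_distrib, Finset.sum_add_distrib] at this
    simp only [Finset.sum_ite_mem, Finset.univ_inter, Finset.sum_const, nsmul_eq_mul, mul_one] at this
    omega
  obtain ⟨f, hfi, hf⟩ := (Finset.all_card_le_biUnion_card_iff_exists_injective t).1 hall
  refine ⟨u, v, Equiv.ofBijective f (Finite.injective_iff_bijective.1 hfi), h, fun p => ?_⟩
  have := hf p
  simpa [t] using this

/-- `Reach σ p x`: following `σ` upward from `x` one arrives at `p`. -/
inductive Reach {α : Type} [PartialOrder α] (σ : α ≃ α) (p : α) : α → Prop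
  | refl : Reach σ p p
  | step (x : α) : x < σ x → Reach σ p (σ x) → Reach σ p x

lemma Reach.le {α : Type} [PartialOrder α] {σ : α ≃ α} {p x : α} (h : Reach σ p x) : x ≤ p := by
  induction h with
  | refl => exact le_rfl
  | step x hx _ ih => exact hx.le.trans ih

lemma Reach.comparable {α : Type} [PartialOrder α] {σ : α ≃ α} {p x y : α}
    (h : Reach σ p x) (h' : Reach σ p y) : Reach σ x y ∨ Reach σ y x := by
  induction h generalizing y with
  | refl => exact Or.inl h'
  | step x hx hr ih =>
    rcases ih h' with h1 | h1
    · cases h1 with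
      | refl => right; exact Reach.step x hx Reach.refl
      | step _ hy hr' =>
        left
        clear ih h'
        have : ∀ z, Reach σ (σ x) z → z = σ x ∨ Reach σ x z := by
          intro z hz
          induction hz with
          | refl => exact Or.inl rfl
          | step z hz _ ihz =>
            right
            rcases ihz with e | e
            · have := σ.injective e; subst this; exact Reach.refl
            · exact Reach.step z hz e
        rcases this y (Reach.step y hy hr') with e | e
        · exfalso
          subst e
          exact absurd (lt_of_lt_of_le hy hr'.le) (lt_irrefl _)
        · exact e
    · right; exact Reach.step x hx h1

open Classical in
/-- Greene–Kleitman. -/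
lemma greene_kleitman_s2 (α : Type) [Fintype α] [PartialOrder α] (k : ℕ) :
    ∃ (m : ℕ) (C : Fin m → Set α), (∀ i, IsChain (· ≤ ·) (C i)) ∧
      k * m + ((⋃ i, C i)ᶜ : Set α).ncard ≤ dk α k := by
  rcases Nat.eq_zero_or_pos k with rfl | hk
  · refine ⟨Fintype.card α, fun i => {(Fintype.equivFin α).symm i}, by simp, ?_⟩
    have : (⋃ i, ({(Fintype.equivFin α).symm i} : Set α)) = Set.univ := by
      ext x; simp only [Set.mem_iUnion, Set.mem_singleton_iff, Set.mem_univ, iff_true]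
      exact ⟨Fintype.equivFin α x, by simp⟩
    rw [this]; simp
  cases isEmpty_or_nonempty α with
  | inl he => exact ⟨0, fun i => ∅, by simp, by simp⟩
  | inr hne =>
  let w : α → α → ℤ := fun p q => if p < q then k else if p = q then k - 1 else 0
  have hw : ∀ p q, 0 ≤ w p q := by
    intro p q; simp only [w]; split_ifs <;> omega
  obtain ⟨u₀, v₀, σ, h₀, he₀⟩ := egervary w
  obtain ⟨q₀, hq₀⟩ := Finite.exists_min v₀
  obtain ⟨u, v, hu, hv, h, he⟩ : ∃ u v : α → ℤ, (∀ p, 0 ≤ u p) ∧ (∀ p, 0 ≤ v p) ∧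
      (∀ p q, w p q ≤ u p + v q) ∧ ∀ p, w p (σ p) = u p + v (σ p) := by
    refine ⟨fun p => u₀ p + v₀ q₀, fun q => v₀ q - v₀ q₀, fun p => ?_, fun q => ?_, fun p q => ?_, fun p => ?_⟩
    · exact (hw p q₀).trans (h₀ p q₀)
    · have := hq₀ q; simp only; linarith
    · have := h₀ p q; linarith
    · have := he₀ p; linarith
  let A : Fin k → Set α := fun i => {p | u p + v p = k - 1 ∧ u p = i}
  have hA : ∀ i, IsAntichain (· ≤ ·) (A i) := by
    rintro i p ⟨hp, hp'⟩ q ⟨hq, hq'⟩ hne hle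
    have h1 := h p q
    have : w p q = k := by simp [w, lt_of_le_of_ne hle hne]
    omega
  have hAu : (⋃ i, A i) = {p | u p + v p = k - 1} := by
    ext p
    simp only [Set.mem_iUnion, A, Set.mem_ofPred_eq]
    constructor
    · rintro ⟨i, h1, -⟩; exact h1
    · intro h1
      have := hu p; have := hv p
      exact ⟨⟨(u p).toNat, by omega⟩, h1, by simp [hu p]⟩
  have hdk := le_dk A hA
  rw [hAu] at hdk
  let N : Finset α := Finset.univ.filter fun p => ¬ p ≤ σ p
  let F : Finset α := Finset.univ.filter fun p => σ p = p
  have hcost : (k * N.card + F.card : ℤ) ≤ ({p | u p + v p = k - 1} : Set α).ncard := by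
    have e1 : (k * N.card + F.card : ℤ) = ∑ p, (k - w p (σ p)) := by
      simp only [N, F, Finset.card_filter]
      push_cast
      rw [Finset.mul_sum, ← Finset.sum_add_distrib]
      refine Finset.sum_congr rfl fun p _ => ?_
      by_cases h1 : σ p = p
      · simp [h1, w]
      · by_cases h2 : p ≤ σ p
        · have : p < σ p := lt_of_le_of_ne h2 (Ne.symm h1)
          simp [h1, h2, w, this]
        · have : ¬ p < σ p := fun h => h2 h.le
          simp [h1, h2, w, this, Ne.symm h1]
    have e2 : ∑ p, ((k : ℤ) - w p (σ p)) = ∑ p, (k - (u p + v p)) := by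
      simp only [he]
      rw [Finset.sum_sub_distrib, Finset.sum_sub_distrib, Finset.sum_add_distrib, Finset.sum_add_distrib,
        Equiv.sum_comp σ v]
    rw [e1, e2, Set.ncard_eq_toFinset_card', Set.toFinset_ofPred, Finset.card_filter]
    push_cast
    refine Finset.sum_le_sum fun p _ => ?_
    have := h p p
    simp only [w, lt_irrefl, if_false, if_true] at this
    split_ifs <;> omega
  refine ⟨N.card, fun i => {x | Reach σ (N.equivFin.symm i : α) x}, fun i => ?_, ?_⟩
  · intro x hx y hy _
    rcases Reach.comparable hx hy with h | h
    · exact Or.inr h.le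
    · exact Or.inl h.le
  · have hcov : ∀ x : α, σ x ≠ x → ∃ p ∈ N, Reach σ p x := by
      intro x
      induction x using WellFoundedGT.induction with
      | ind x ih =>
        intro hx
        by_cases hle : x ≤ σ x
        · have hlt := lt_of_le_of_ne hle (Ne.symm hx)
          obtain ⟨p, hp, hr⟩ := ih (σ x) hlt (fun e => hx (σ.injective e))
          exact ⟨p, hp, Reach.step x hlt hr⟩
        · exact ⟨x, by simp [N, hle], Reach.refl⟩
    have hsub : ((⋃ i, {x | Reach σ (N.equivFin.symm i : α) x})ᶜ : Set α) ⊆ (F : Set α) := by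
      intro x hx
      by_contra hxF
      obtain ⟨p, hp, hr⟩ := hcov x (by simpa [F] using hxF)
      exact hx (Set.mem_iUnion.2 ⟨N.equivFin ⟨p, hp⟩, by simpa using hr⟩)
    have := Set.ncard_le_ncard hsub (Set.toFinite _)
    rw [Set.ncard_coe_finset] at this
    have h5 : k * N.card + F.card ≤ ({p | u p + v p = k - 1} : Set α).ncard := by exact_mod_cast hcost
    exact (Nat.add_le_add_left this _).trans (h5.trans hdk)

end Helpers

section Helpers2

lemma unichain_cover_le {α β : Type} [Fintype α] [PartialOrder α] [Fintype β] [PartialOrder β]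
    {ι : Type} [Fintype ι] (U : ι → Set (α × β)) (hU : ∀ i, IsUnichain (U i))
    (hc : ∀ x, ∃ i, x ∈ U i) : minUnichainCover α β ≤ Fintype.card ι := by
  refine Nat.sInf_le ⟨fun i => U ((Fintype.equivFin ι).symm i), fun i => hU _, ?_⟩
  refine Set.eq_univ_of_forall fun x => ?_
  obtain ⟨i, hi⟩ := hc x
  exact Set.mem_iUnion.2 ⟨Fintype.equivFin ι i, by simpa using hi⟩

lemma semi_le {α β : Type} [Fintype α] [PartialOrder α] [Fintype β] [PartialOrder β]
    {S : Set (α × β)} (hS : IsSemiantichain S) : S.ncard ≤ maxSemiantichain α β := by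
  refine le_csSup ⟨Nat.card (α × β), ?_⟩ ⟨S, hS, rfl⟩
  rintro n ⟨S, -, rfl⟩
  exact Set.ncard_le_card _

open Classical in
lemma weak_duality (α β : Type) [Fintype α] [PartialOrder α] [Fintype β] [PartialOrder β] :
    maxSemiantichain α β ≤ minUnichainCover α β := by
  refine csSup_le' ?_
  rintro n ⟨S, hS, rfl⟩
  have hne : {n | ∃ U : Fin n → Set (α × β), (∀ i, IsUnichain (U i)) ∧ (⋃ i, U i) = Set.univ}.Nonempty := by
    refine ⟨Fintype.card (α × β), fun i => {(Fintype.equivFin (α × β)).symm i}, fun i => ?_, ?_⟩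
    · left
      exact ⟨((Fintype.equivFin (α × β)).symm i).1, {((Fintype.equivFin (α × β)).symm i).2}, by simp, by simp⟩
    · refine Set.eq_univ_of_forall fun x => ?_
      exact Set.mem_iUnion.2 ⟨Fintype.equivFin _ x, by simp⟩
  obtain ⟨U, hU, hc⟩ := Nat.sInf_mem hne
  have hx : ∀ x, ∃ i, x ∈ U i := fun x => Set.mem_iUnion.1 (by rw [hc]; trivial)
  choose g hg using hx
  change S.ncard ≤ minUnichainCover α β
  have : Set.InjOn g S := by
    intro x hx y hy hxy
    by_contra hne
    exact hS x hx y hy hne (U (g x)) (hU _) ⟨hg x, hxy ▸ hg y⟩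
  have h1 := Set.InjOn.ncard_image this
  rw [← h1]
  exact (Set.ncard_le_card _).trans (by rw [Nat.card_eq_fintype_card, Fintype.card_fin]; exact le_rfl)

open Classical in
/-- A chain times `β` is covered by few unichains. -/
lemma cover_strip {α β : Type} [Fintype α] [PartialOrder α] [Fintype β] [PartialOrder β]
    (C : Finset α) (hC : IsChain (· ≤ ·) (C : Set α)) :
    ∃ (ι : Type) (_ : Fintype ι) (U : ι → Set (α × β)), (∀ i, IsUnichain (U i)) ∧
      (∀ x : α × β, x.1 ∈ C → ∃ i, x ∈ U i) ∧ Fintype.card ι ≤ dk β C.card := by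
  obtain ⟨m, D, hD, hcard⟩ := greene_kleitman_s2 β C.card
  refine ⟨(C × Fin m) ⊕ ((⋃ i, D i)ᶜ : Set β), inferInstance,
    Sum.elim (fun x => ({(x.1 : α)} : Set α) ×ˢ D x.2) (fun q => (C : Set α) ×ˢ ({(q : β)} : Set β)), ?_, ?_, ?_⟩
  · rintro (x | q)
    · left; exact ⟨_, _, hD _, rfl⟩
    · right; exact ⟨_, _, hC, rfl⟩
  · rintro ⟨p, q⟩ hp
    by_cases h : q ∈ ⋃ i, D i
    · obtain ⟨i, hi⟩ := Set.mem_iUnion.1 h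
      exact ⟨Sum.inl (⟨p, hp⟩, i), by simpa using hi⟩
    · exact ⟨Sum.inr ⟨q, h⟩, by simpa using hp⟩
  · rw [Fintype.card_sum, Fintype.card_prod, Fintype.card_fin, Fintype.card_coe]
    rwa [← Nat.card_eq_fintype_card, Nat.card_coe_set_eq]

open Classical in
/-- Weak duality between `k`-families and chain partitions. -/
lemma dk_le_sum {α : Type} [Fintype α] [PartialOrder α] (k w : ℕ) (C : ℕ → Finset α)
    (hC : ∀ i, IsChain (· ≤ ·) (C i : Set α)) (hcov : ∀ x, ∃ i < w, x ∈ C i) :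
    dk α k ≤ ∑ j ∈ Finset.range w, min (C j).card k := by
  obtain ⟨A, hA, h⟩ := exists_dk α k
  rw [← h]
  have hsub : (⋃ i, A i).toFinset ⊆ (Finset.range w).biUnion fun j => C j ∩ (⋃ i, A i).toFinset := by
    intro x hx
    obtain ⟨i, hi, hxi⟩ := hcov x
    exact Finset.mem_biUnion.2 ⟨i, by simpa using hi, Finset.mem_inter.2 ⟨hxi, hx⟩⟩
  rw [Set.ncard_eq_toFinset_card']
  refine (Finset.card_le_card hsub).trans (Finset.card_biUnion_le.trans (Finset.sum_le_sum fun j _ => ?_))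
  refine le_min (Finset.card_le_card Finset.inter_subset_left) ?_
  have hx : ∀ x ∈ C j ∩ (⋃ i, A i).toFinset, ∃ i, x ∈ A i := by
    intro x hx; simpa using (Finset.mem_inter.1 hx).2
  rcases (C j ∩ (⋃ i, A i).toFinset).eq_empty_or_nonempty with h0 | ⟨x0, hx0⟩
  · simp [h0]
  obtain ⟨i0, -⟩ := hx x0 hx0
  have : Nonempty (Fin k) := ⟨i0⟩
  choose! g hg using hx
  have := Finset.card_le_card_of_injOn (s := C j ∩ (⋃ i, A i).toFinset) (t := Finset.univ) g (by simp) (by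
    intro x hx y hy hxy
    by_contra hne
    have hx1 := hg x hx
    have hy1 := hg y hy
    rw [← hxy] at hy1
    have hx2 : x ∈ C j := (Finset.mem_inter.1 hx).1
    have hy2 : y ∈ C j := (Finset.mem_inter.1 hy).1
    rcases hC j (by simpa using hx2) (by simpa using hy2) hne with hle | hle
    · exact hA _ hx1 hy1 hne hle
    · exact hA _ hy1 hx1 (Ne.symm hne) hle)
  simpa using this

/-- The conjugacy part of Greene's theorem. -/
lemma sum_le_dk {α : Type} [Fintype α] [PartialOrder α] (k w : ℕ) (l : ℕ → ℕ)
    (hs : ∀ m, m ≤ w → ck α m = ∑ j ∈ Finset.range m, l j) (hw : ck α w = Fintype.card α) :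
    ∑ j ∈ Finset.range w, min (l j) k ≤ dk α k := by
  obtain ⟨m, D, hD, hcard⟩ := greene_kleitman_s2 α k
  have h1 := le_ck D hD
  have h2 := Set.ncard_add_ncard_compl (⋃ i, D i)
  rw [Nat.card_eq_fintype_card] at h2
  refine le_trans ?_ hcard
  rcases le_total w m with hm | hm
  · calc _ ≤ ∑ j ∈ Finset.range w, k := Finset.sum_le_sum fun j _ => min_le_right _ _
      _ = k * w := by simp [mul_comm]
      _ ≤ k * m := Nat.mul_le_mul_left _ hm
      _ ≤ _ := Nat.le_add_right _ _
  · have h3 := hs m hm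
    have h4 := hs w le_rfl
    rw [← Finset.sum_range_add_sum_Ico _ hm] at h4 ⊢
    have a1 : ∑ j ∈ Finset.range m, min (l j) k ≤ k * m :=
      (Finset.sum_le_sum fun j _ => min_le_right _ _).trans (by simp [mul_comm])
    have a2 : ∑ j ∈ Finset.Ico m w, min (l j) k ≤ ∑ j ∈ Finset.Ico m w, l j :=
      Finset.sum_le_sum fun j _ => min_le_left _ _
    omega

lemma dk_telescope (α : Type) [Fintype α] [PartialOrder α] (k : ℕ) :
    dk α k = ∑ i ∈ Finset.range k, (dk α (i + 1) - dk α i) := by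
  induction k with
  | zero => simp [dk_zero]
  | succ k ih =>
    rw [Finset.sum_range_succ, ← ih]
    have := dk_mono α (Nat.le_succ k)
    simp only [Nat.succ_eq_add_one] at this
    omega

lemma chain_card_le {α : Type} [Fintype α] [PartialOrder α] (C : Finset α)
    (hC : IsChain (· ≤ ·) (C : Set α)) : C.card ≤ heightP α := by
  refine le_csSup ⟨Nat.card α, ?_⟩ ⟨C, hC, Set.ncard_coe_finset _⟩
  rintro n ⟨S, -, rfl⟩
  exact Set.ncard_le_card _

open Classical in
lemma lower_bound {α β : Type} [Fintype α] [PartialOrder α] [Fintype β] [PartialOrder β]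
    (n : ℕ) (A : ℕ → Finset α) (B : ℕ → Finset β)
    (hA : ∀ i, IsAntichain (· ≤ ·) (A i : Set α)) (hB : ∀ i, IsAntichain (· ≤ ·) (B i : Set β))
    (hAd : ∀ i j, i ≠ j → Disjoint (A i) (A j)) (hBd : ∀ i j, i ≠ j → Disjoint (B i) (B j)) :
    ∑ i ∈ Finset.range n, (A i).card * (B i).card ≤ maxSemiantichain α β := by
  let S : Finset (α × β) := (Finset.range n).biUnion fun i => A i ×ˢ B i
  have hS : IsSemiantichain (S : Set (α × β)) := by
    rintro ⟨p, q⟩ hx ⟨p', q'⟩ hy hne U hU ⟨hxU, hyU⟩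
    simp only [S, Finset.coe_biUnion, Set.mem_iUnion, Finset.mem_coe, Finset.mem_product] at hx hy
    obtain ⟨i, -, hp, hq⟩ := hx
    obtain ⟨j, -, hp', hq'⟩ := hy
    rcases hU with ⟨r, C, hC, rfl⟩ | ⟨r, C, hC, rfl⟩
    · simp only [Set.mem_prod, Set.mem_singleton_iff] at hxU hyU
      obtain ⟨rfl, hqC⟩ := hxU
      obtain ⟨rfl, hqC'⟩ := hyU
      have hij : i = j := by
        by_contra h
        exact Finset.disjoint_left.1 (hAd i j h) hp hp'
      subst hij
      have hqq : q ≠ q' := fun h => hne (by rw [h])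
      rcases hC hqC hqC' hqq with h | h
      · exact hB i hq hq' hqq h
      · exact hB i hq' hq (Ne.symm hqq) h
    · simp only [Set.mem_prod, Set.mem_singleton_iff] at hxU hyU
      obtain ⟨hpC, rfl⟩ := hxU
      obtain ⟨hpC', rfl⟩ := hyU
      have hij : i = j := by
        by_contra h
        exact Finset.disjoint_left.1 (hBd i j h) hq hq'
      subst hij
      have hpp : p ≠ p' := fun h => hne (by rw [h])
      rcases hC hpC hpC' hpp with h | h
      · exact hA i hp hp' hpp h
      · exact hA i hp' hp (Ne.symm hpp) h
  have := semi_le hS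
  rw [Set.ncard_coe_finset] at this
  refine le_trans (le_of_eq ?_) this
  rw [Finset.card_biUnion]
  · simp
  · intro i _ j _ hij
    exact Finset.disjoint_product.2 (Or.inl (hAd i j hij))

end Helpers2

/-- Tovey–West / Theorem `thm:main`: if `P` is d-decomposable and
c-decomposable and `Q` is d-decomposable, then the maximum size of a
semiantichain in `P × Q` equals the minimum number of unichains needed to
cover `P × Q`, and this common value is
`∑_{i=1}^{min(h(P),h(Q))} μ_i^P μ_i^Q = ∑_{j=1}^{w(P)} d_{λ_j^P}(Q)`,
where `μ_i = d_i - d_{i-1}` and `λ_j = c_j - c_{j-1}` are the parts of the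
Greene partition and its conjugate. -/
theorem semiantichain_unichain_duality_of_decomposable
    (α β : Type) [Fintype α] [PartialOrder α] [Fintype β] [PartialOrder β]
    (hPd : DDecomposable α) (hPc : CDecomposable α) (hQd : DDecomposable β) :
    maxSemiantichain α β = minUnichainCover α β ∧
    maxSemiantichain α β =
      ∑ i ∈ Finset.range (min (heightP α) (heightP β)),
        (dk α (i + 1) - dk α i) * (dk β (i + 1) - dk β i) ∧
    maxSemiantichain α β =
      ∑ j ∈ Finset.range (widthP α), dk β (ck α (j + 1) - ck α j) := by
  classical
  obtain ⟨A₀, hA₀, hAd₀, hAc₀, hAk⟩ := hPd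
  obtain ⟨B₀, hB₀, hBd₀, hBc₀, hBk⟩ := hQd
  obtain ⟨C₀, hC₀, hCd₀, hCc₀, hCk⟩ := hPc
  obtain ⟨A, hA, hAd, -, hAs, -, -⟩ := decomp_aux A₀ (dk α) hAd₀ hAc₀ hAk
  obtain ⟨B, hB, hBd, -, hBs, hBn, -⟩ := decomp_aux B₀ (dk β) hBd₀ hBc₀ hBk
  obtain ⟨C, hC, -, hCc, hCs, hCn, hC0⟩ := decomp_aux C₀ (ck α) hCd₀ hCc₀ hCk
  have hA' : ∀ i, IsAntichain (· ≤ ·) (A i : Set α) := by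
    intro i
    rcases hA i with h | ⟨j, h⟩
    · simp [h]
    · rw [h]; exact hA₀ j
  have hB' : ∀ i, IsAntichain (· ≤ ·) (B i : Set β) := by
    intro i
    rcases hB i with h | ⟨j, h⟩
    · simp [h]
    · rw [h]; exact hB₀ j
  have hC' : ∀ i, IsChain (· ≤ ·) (C i : Set α) := by
    intro i
    rcases hC i with h | ⟨j, h⟩
    · simp [h]
    · rw [h]; exact hC₀ j
  have hcs : ∀ m, m ≤ widthP α → ck α m = ∑ j ∈ Finset.range m, (C j).card := by
    intro m hm
    induction m with
    | zero => simp [hC0]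
    | succ m ih => rw [Finset.sum_range_succ, ← ih (by omega), hCs m (by omega)]
  have h1 : ∑ i ∈ Finset.range (min (heightP α) (heightP β)),
        (dk α (i + 1) - dk α i) * (dk β (i + 1) - dk β i) ≤ maxSemiantichain α β := by
    refine le_trans (le_of_eq (Finset.sum_congr rfl fun i hi => ?_))
      (lower_bound (min (heightP α) (heightP β)) A B hA' hB' hAd hBd)
    have hi := Finset.mem_range.1 hi
    rw [hAs i (by omega), hBs i (by omega)]
    simp
  have h2 := weak_duality α β
  have hck : ∀ j ∈ Finset.range (widthP α), dk β (ck α (j + 1) - ck α j) = dk β (C j).card := by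
    intro j hj
    rw [hCs j (Finset.mem_range.1 hj)]; simp
  have h3 : minUnichainCover α β ≤
      ∑ j ∈ Finset.range (widthP α), dk β (ck α (j + 1) - ck α j) := by
    rw [Finset.sum_congr rfl hck]
    choose ι hι U hU hUc hUn using fun j => cover_strip (β := β) (C j) (hC' j)
    have := unichain_cover_le (ι := Σ j : Fin (widthP α), ι j) (fun x => U x.1 x.2)
      (fun x => hU _ _) (by
        intro x
        obtain ⟨j, hj, hx⟩ := hCc x.1
        obtain ⟨i, hi⟩ := hUc j x hx
        exact ⟨⟨⟨j, hj⟩, i⟩, hi⟩)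
    refine this.trans ?_
    rw [Fintype.card_sigma, ← Fin.sum_univ_eq_sum_range (fun j => dk β (C j).card)]
    exact Finset.sum_le_sum fun j _ => hUn j
  have hconj : ∀ k, dk α k = ∑ j ∈ Finset.range (widthP α), min (C j).card k := fun k =>
    le_antisymm (dk_le_sum k _ C hC' hCc) (sum_le_dk k _ _ hcs hCn)
  have hmu : ∀ i, dk α (i + 1) - dk α i =
      ∑ j ∈ Finset.range (widthP α), if i < (C j).card then 1 else 0 := by
    intro i
    have : dk α (i + 1) = dk α i +
        ∑ j ∈ Finset.range (widthP α), if i < (C j).card then 1 else 0 := by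
      rw [hconj, hconj, ← Finset.sum_add_distrib]
      refine Finset.sum_congr rfl fun j _ => ?_
      split_ifs <;> omega
    omega
  have h4 : ∑ j ∈ Finset.range (widthP α), dk β (ck α (j + 1) - ck α j) =
      ∑ i ∈ Finset.range (min (heightP α) (heightP β)),
        (dk α (i + 1) - dk α i) * (dk β (i + 1) - dk β i) := by
    rw [Finset.sum_congr rfl hck]
    have e1 : ∀ i, (dk α (i + 1) - dk α i) * (dk β (i + 1) - dk β i) =
        ∑ j ∈ Finset.range (widthP α), if i < (C j).card then (dk β (i + 1) - dk β i) else 0 := by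
      intro i
      rw [hmu, Finset.sum_mul]
      refine Finset.sum_congr rfl fun j _ => ?_
      split_ifs <;> simp
    simp only [e1]
    rw [Finset.sum_comm]
    refine Finset.sum_congr rfl fun j _ => ?_
    rw [← Finset.sum_filter, dk_telescope β (C j).card]
    symm
    refine Finset.sum_subset ?_ ?_
    · intro i hi
      simpa using (Finset.mem_filter.1 hi).2
    · intro i hi hi'
      have hi := Finset.mem_range.1 hi
      have hh := chain_card_le (C j) (hC' j)
      have : heightP β ≤ i := by
        by_contra hlt
        exact hi' (Finset.mem_filter.2 ⟨Finset.mem_range.2 (by omega), hi⟩)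
      have m1 := dk_mono β this
      have m2 := dk_le_card β (i + 1)
      omega
  refine ⟨?_, ?_, ?_⟩ <;> omega
end

section
/- Let C be a finite chain and Q a finite poset. Then the maximum size of an antichain in the product C×Q equals the minimum number of unichains needed to cover C×Q, and this common value is d_{|C|}(Q). -/
/-- Integer assignment duality (Egerváry). -/
theorem assignment_duality {β : Type*} [Fintype β] (w : β → β → ℤ) :
    ∃ (σ : Equiv.Perm β) (u v : β → ℤ), (∀ x y, w x y ≤ u x + v y) ∧
      ∀ x, u x + v (σ x) = w x (σ x) := by
  classical
  -- minimal feasible potentials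
  let P : ℤ → Prop := fun s => ∃ u v : β → ℤ, (∀ x y, w x y ≤ u x + v y) ∧
    ∑ x, u x + ∑ x, v x = s
  have hne : ∃ s, P s := by
    refine ⟨_, fun x => ∑ y, |w x y|, fun _ => 0, ?_, rfl⟩
    intro x y
    have := Finset.single_le_sum (f := fun y => |w x y|) (fun i _ => abs_nonneg _)
      (Finset.mem_univ y)
    have h2 := le_abs_self (w x y)
    linarith
  have hbd : ∃ b, ∀ s, P s → b ≤ s := by
    refine ⟨∑ x, w x x, ?_⟩
    rintro s ⟨u, v, h, rfl⟩
    rw [← Finset.sum_add_distrib]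
    exact Finset.sum_le_sum fun x _ => h x x
  obtain ⟨s, ⟨u, v, h, hs⟩, hmin⟩ := Int.exists_least_of_bdd hbd hne
  let N : β → Finset β := fun x => Finset.univ.filter fun y => u x + v y = w x y
  have hall : ∀ S : Finset β, S.card ≤ (S.biUnion N).card := by
    intro S
    by_contra! hlt
    have := hmin (s - S.card + (S.biUnion N).card)
      ⟨fun x => u x - if x ∈ S then 1 else 0,
        fun y => v y + if y ∈ S.biUnion N then 1 else 0, ?_, ?_⟩
    · omega
    · intro x y
      have hxy := h x y
      by_cases hx : x ∈ S
      · by_cases hy : y ∈ S.biUnion N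
        · simp only [hx, hy, if_true]; omega
        · have : u x + v y ≠ w x y := by
            intro he
            exact hy (Finset.mem_biUnion.2 ⟨x, hx, by simp [N, he]⟩)
          simp only [hx, hy, if_true, if_false]; omega
      · simp only [hx, if_false]
        split_ifs <;> omega
    · rw [Finset.sum_sub_distrib, Finset.sum_add_distrib, ← hs]
      simp only [Finset.sum_ite_mem, Finset.univ_inter, Finset.sum_const, nsmul_eq_mul, mul_one]
      ring
  obtain ⟨f, hf, hfN⟩ := (Finset.all_card_le_biUnion_card_iff_exists_injective N).1 hall
  refine ⟨Equiv.ofBijective f (Finite.injective_iff_bijective.1 hf), u, v, h, ?_⟩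
  intro x
  have := hfN x
  simpa [N] using this

theorem greene_kleitman_key {β : Type*} [Fintype β] [PartialOrder β] (k : ℕ) (hk : 0 < k) :
    ∃ (R T F : Finset β) (top : β → β) (v : β → ℕ),
      (∀ x, x ∉ R → top x ∈ T) ∧
      (∀ x y, x ∉ R → y ∉ R → top x = top y → x ≤ y ∨ y ≤ x) ∧
      R.card + k * T.card ≤ F.card ∧
      (∀ x ∈ F, v x < k) ∧
      (∀ x ∈ F, ∀ y ∈ F, x < y → v x < v y) := by
  classical
  rcases isEmpty_or_nonempty β with hE | hN
  · exact ⟨∅, ∅, ∅, id, fun _ => 0, fun x => hE.elim x, fun x => hE.elim x, by simp, by simp,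
      by simp⟩
  let w : β → β → ℤ := fun x y => if x < y then (k : ℤ) else if x = y then (k : ℤ) - 1 else 0
  have hw0 : ∀ x y, 0 ≤ w x y := by
    intro x y
    simp only [w]
    split_ifs <;> omega
  obtain ⟨σ, u', v', hc', ht'⟩ := assignment_duality w
  obtain ⟨y0, hy0⟩ := Finite.exists_min v'
  obtain ⟨u, v, hc, ht, hu, hv⟩ : ∃ u v : β → ℤ, (∀ x y, w x y ≤ u x + v y) ∧
      (∀ x, u x + v (σ x) = w x (σ x)) ∧ (∀ x, 0 ≤ u x) ∧ (∀ x, 0 ≤ v x) := by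
    refine ⟨fun x => u' x + v' y0, fun y => v' y - v' y0, ?_, ?_, ?_, ?_⟩
    · intro x y; have := hc' x y; simp only; linarith
    · intro x; have := ht' x; simp only; linarith
    · intro x; have := hc' x y0; have := hw0 x y0; simp only; linarith
    · intro x; have := hy0 x; simp only; linarith
  let R : Finset β := Finset.univ.filter fun x => σ x = x
  let T : Finset β := Finset.univ.filter fun x => ¬ x ≤ σ x
  let F : Finset β := Finset.univ.filter fun x => u x + v x = k - 1
  have htop : ∀ x, x ∉ R → ∃ t, t ∈ T ∧ ∃ a : ℕ, (σ ^ a) x = t ∧ ∀ j ≤ a, x ≤ (σ ^ j) x := by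
    intro x
    induction x using (wellFounded_gt (α := β)).induction with
    | _ x ih =>
      intro hx
      by_cases hxT : x ∈ T
      · refine ⟨x, hxT, 0, by simp, ?_⟩
        intro j hj
        obtain rfl : j = 0 := by omega
        simp
      · have hle : x ≤ σ x := by simpa [T] using hxT
        have hne : σ x ≠ x := by simpa [R] using hx
        have hR : σ x ∉ R := by
          simp only [R, Finset.mem_filter, Finset.mem_univ, true_and]
          intro h; exact hne (σ.injective h)
        obtain ⟨t, htT, a, ha, hj⟩ := ih (σ x) (lt_of_le_of_ne hle hne.symm) hR
        refine ⟨t, htT, a + 1, by rw [pow_succ, Equiv.Perm.mul_apply, ha], ?_⟩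
        intro j hja
        cases j with
        | zero => simp
        | succ j =>
          rw [pow_succ, Equiv.Perm.mul_apply]
          exact hle.trans (hj j (by omega))
  have htop' : ∀ x, ∃ t, x ∉ R → t ∈ T ∧ ∃ a : ℕ, (σ ^ a) x = t ∧ ∀ j ≤ a, x ≤ (σ ^ j) x := by
    intro x
    by_cases hx : x ∈ R
    · exact ⟨x, fun h => absurd hx h⟩
    · obtain ⟨t, h⟩ := htop x hx
      exact ⟨t, fun _ => h⟩
  choose top hT using htop'
  have haux : ∀ (x y : β) (a b : ℕ), (σ ^ a) x = (σ ^ b) y → a ≤ b →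
      (∀ j ≤ b, y ≤ (σ ^ j) y) → y ≤ x := by
    intro x y a b he hab hj
    have : x = (σ ^ (b - a)) y := by
      apply (σ ^ a).injective
      rw [he, ← Equiv.Perm.mul_apply, ← pow_add]
      congr 2; omega
    rw [this]
    exact hj _ (by omega)
  refine ⟨R, T, F, top, fun x => (v x).toNat, fun x hx => (hT x hx).1, ?_, ?_, ?_, ?_⟩
  · intro x y hx hy hxy
    obtain ⟨_, a, ha, hja⟩ := hT x hx
    obtain ⟨_, b, hb, hjb⟩ := hT y hy
    have he : (σ ^ a) x = (σ ^ b) y := by rw [ha, hb, hxy]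
    rcases le_total a b with h | h
    · exact Or.inr (haux x y a b he h hjb)
    · exact Or.inl (haux y x b a he.symm h hja)
  · have h1 : ∀ x, w x (σ x) = k - (if x ∈ R then 1 else 0) - (if x ∈ T then (k : ℤ) else 0) := by
      intro x
      by_cases h : σ x = x
      · simp [w, R, T, h]
      · by_cases h2 : x ≤ σ x
        · have h3 : x < σ x := lt_of_le_of_ne h2 (Ne.symm h)
          simp [w, R, T, h, h2, h3]
        · have h3 : ¬ x < σ x := fun h' => h2 h'.le
          simp [w, R, T, h, h2, h3, Ne.symm h]
    have h2 : ∑ x, (u x + v x) = ∑ x, w x (σ x) := by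
      rw [Finset.sum_add_distrib, ← Equiv.sum_comp σ v, ← Finset.sum_add_distrib]
      exact Finset.sum_congr rfl fun x _ => ht x
    have h3 : ∑ x, (k - (u x + v x)) ≤ ∑ x, (if x ∈ F then (1 : ℤ) else 0) := by
      apply Finset.sum_le_sum
      intro x _
      have := hc x x
      simp only [w, lt_irrefl, if_false, if_true] at this
      by_cases hF : x ∈ F
      · simp only [hF, if_true]; omega
      · have : u x + v x ≠ k - 1 := by simpa [F] using hF
        simp only [hF, if_false]; omega
    rw [Finset.sum_sub_distrib, h2, Finset.sum_congr rfl fun x _ => h1 x,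
      Finset.sum_sub_distrib, Finset.sum_sub_distrib] at h3
    simp only [Finset.sum_ite_mem, Finset.univ_inter, Finset.sum_const, nsmul_eq_mul,
      mul_one] at h3
    have : (R.card : ℤ) + k * T.card ≤ F.card := by linarith
    exact_mod_cast this
  · intro x hx
    have : u x + v x = k - 1 := by simpa [F] using hx
    have := hu x
    have := hv x
    simp only; omega
  · intro x hx y hy hxy
    have h1 : u x + v x = k - 1 := by simpa [F] using hx
    have h2 := hc x y
    simp only [w, hxy, if_true] at h2
    have := hv x
    have := hv y
    simp only; omega

theorem antichain_ncard_le_cover {α β : Type*} [Finite α] [Finite β] [PartialOrder α]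
    [PartialOrder β] {n : ℕ} (U : Fin n → Set (α × β)) (hU : ∀ i, IsUnichain (U i))
    (hc : (⋃ i, U i) = Set.univ) (A : Set (α × β)) (hA : IsAntichain (· ≤ ·) A) :
    A.ncard ≤ n := by
  classical
  have : ∀ x : α × β, ∃ i, x ∈ U i := by
    intro x
    have : x ∈ ⋃ i, U i := by rw [hc]; trivial
    simpa using this
  choose f hf using this
  have hinj : Set.InjOn f A := by
    intro x hx y hy hxy
    have h1 := hf x
    have h2 := hf y
    rw [hxy] at h1
    have hcomp : x ≤ y ∨ y ≤ x := by
      rcases hU (f y) with ⟨p, C, hC, he⟩ | ⟨q, C, hC, he⟩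
      · rw [he] at h1 h2
        simp only [Set.mem_prod, Set.mem_singleton_iff] at h1 h2
        rcases hC.total h1.2 h2.2 with h | h
        · exact Or.inl ⟨by rw [h1.1, h2.1], h⟩
        · exact Or.inr ⟨by rw [h1.1, h2.1], h⟩
      · rw [he] at h1 h2
        simp only [Set.mem_prod, Set.mem_singleton_iff] at h1 h2
        rcases hC.total h1.1 h2.1 with h | h
        · exact Or.inl ⟨h, by rw [h1.2, h2.2]⟩
        · exact Or.inr ⟨h, by rw [h1.2, h2.2]⟩
    rcases hcomp with h | h
    · exact hA.eq hx hy h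
    · exact (hA.eq hy hx h).symm
  have := Set.ncard_le_ncard_of_injOn (t := (Set.univ : Set (Fin n))) f (fun _ _ => trivial) hinj
  simpa using this

theorem gk_package (α β : Type) [Fintype α] [LinearOrder α] [Fintype β] [PartialOrder β] :
    ∃ N : ℕ,
      (∃ U : Fin N → Set (α × β), (∀ i, IsUnichain (U i)) ∧ (⋃ i, U i) = Set.univ) ∧
      (∃ A : Set (α × β), IsAntichain (· ≤ ·) A ∧ N ≤ A.ncard) ∧
      (∀ A : Fin (Fintype.card α) → Set β, (∀ i, IsAntichain (· ≤ ·) (A i)) →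
        (⋃ i, A i).ncard ≤ N) := by
  classical
  rcases Nat.eq_zero_or_pos (Fintype.card α) with h0 | hk
  · have hE : IsEmpty α := Fintype.card_eq_zero_iff.1 h0
    refine ⟨0, ⟨fun _ => ∅, fun i => i.elim0, ?_⟩, ⟨∅, by simp, by simp⟩, ?_⟩
    · ext x; exact hE.elim x.1
    · intro A _
      have : IsEmpty (Fin (Fintype.card α)) := by rw [h0]; infer_instance
      simp
  obtain ⟨R, T, F, top, v, htop, hchain, hcard, hvk, hvlt⟩ :=
    greene_kleitman_key (β := β) (Fintype.card α) hk
  let e : Fin (Fintype.card α) ≃o α := Fintype.orderIsoFinOfCardEq α rfl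
  have hI : Fintype.card (R ⊕ (α × T)) = R.card + Fintype.card α * T.card := by simp
  refine ⟨R.card + Fintype.card α * T.card, ?_, ?_, ?_⟩
  · let g : Fin (R.card + Fintype.card α * T.card) ≃ (R ⊕ (α × T)) :=
      (Fintype.equivFinOfCardEq hI).symm
    let V : R ⊕ (α × T) → Set (α × β) := fun s => match s with
      | Sum.inl q => (Set.univ : Set α) ×ˢ ({q.1} : Set β)
      | Sum.inr pt => ({pt.1} : Set α) ×ˢ {x | x ∉ R ∧ top x = pt.2.1}
    refine ⟨fun i => V (g i), ?_, ?_⟩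
    · intro i
      rcases hgi : g i with q | ⟨p, t⟩
      · exact Or.inr ⟨q.1, Set.univ, fun x _ y _ _ => le_total x y, by simp [V, hgi]⟩
      · refine Or.inl ⟨p, {x | x ∉ R ∧ top x = t.1}, ?_, by simp [V, hgi]⟩
        intro x hx y hy _
        exact hchain x y hx.1 hy.1 (hx.2.trans hy.2.symm)
    · ext ⟨p, x⟩
      simp only [Set.mem_iUnion, Set.mem_univ, iff_true]
      by_cases hx : x ∈ R
      · exact ⟨g.symm (Sum.inl ⟨x, hx⟩), by simp [V]⟩
      · exact ⟨g.symm (Sum.inr (p, ⟨top x, htop x hx⟩)), by simp [V, hx]⟩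
  · let lev : β → α := fun x => e ⟨Fintype.card α - 1 - v x, by omega⟩
    refine ⟨(fun x => (lev x, x)) '' (F : Set β), ?_, ?_⟩
    · rintro _ ⟨x, hx, rfl⟩ _ ⟨y, hy, rfl⟩ hne hle
      have hx' : x ∈ F := hx
      have hy' : y ∈ F := hy
      have hxy : x ≤ y := hle.2
      have hlev : lev x ≤ lev y := hle.1
      have hlt : x < y := lt_of_le_of_ne hxy (by rintro rfl; exact hne rfl)
      have h1 := hvlt x hx' y hy' hlt
      have h2 := hvk y hy'
      simp only [lev, e.le_iff_le, Fin.mk_le_mk] at hlev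
      omega
    · rw [Set.ncard_image_of_injective _ (fun x y h => (Prod.ext_iff.1 h).2),
        Set.ncard_coe_finset]
      exact hcard
  · intro A hA
    rw [← hI]
    have hex : ∀ x : β, ∃ i : Fin (Fintype.card α), x ∈ (⋃ i, A i) → x ∈ A i := by
      intro x
      by_cases hx : x ∈ ⋃ i, A i
      · obtain ⟨i, hi⟩ := Set.mem_iUnion.1 hx
        exact ⟨i, fun _ => hi⟩
      · exact ⟨⟨0, hk⟩, fun h => absurd h hx⟩
    choose c hc using hex
    let f : β → R ⊕ (α × T) := fun x =>
      if hx : x ∈ R then Sum.inl ⟨x, hx⟩ else Sum.inr (e (c x), ⟨top x, htop x hx⟩)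
    have hinj : Set.InjOn f (⋃ i, A i) := by
      intro x hx y hy hxy
      by_cases hxR : x ∈ R <;> by_cases hyR : y ∈ R <;>
        simp only [f, hxR, hyR, dif_pos, dif_neg, not_false_eq_true, Sum.inl.injEq,
          Sum.inr.injEq, Prod.mk.injEq, Subtype.mk.injEq, reduceCtorEq] at hxy
      · exact hxy
      · have hcc : c x = c y := e.injective hxy.1
        have h1 := hc x hx
        have h2 := hc y hy
        rw [hcc] at h1
        rcases hchain x y hxR hyR hxy.2 with h | h
        · exact (hA _).eq h1 h2 h
        · exact ((hA _).eq h2 h1 h).symm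
    have := Set.ncard_le_ncard_of_injOn (t := (Set.univ : Set (R ⊕ (α × T)))) f
      (fun _ _ => trivial) hinj
    rwa [Set.ncard_univ, Nat.card_eq_fintype_card] at this

theorem antichain_unichain_duality_chain_times_poset
    (α β : Type) [Fintype α] [LinearOrder α] [Fintype β] [PartialOrder β] :
    widthP (α × β) = minUnichainCover α β ∧
    widthP (α × β) = dk β (Fintype.card α) := by
  classical
  obtain ⟨N, hU, ⟨A, hA, hNA⟩, hd⟩ := gk_package α β
  have e : Fin (Fintype.card α) ≃o α := Fintype.orderIsoFinOfCardEq α rfl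
  have hcov : minUnichainCover α β ≤ N := Nat.sInf_le hU
  have hwc : ∀ B : Set (α × β), IsAntichain (· ≤ ·) B → B.ncard ≤ minUnichainCover α β := by
    intro B hB
    obtain ⟨U, hU1, hU2⟩ := Nat.sInf_mem (s := {n | ∃ U : Fin n → Set (α × β),
      (∀ i, IsUnichain (U i)) ∧ (⋃ i, U i) = Set.univ}) ⟨N, hU⟩
    exact antichain_ncard_le_cover U hU1 hU2 B hB
  have hw1 : widthP (α × β) ≤ minUnichainCover α β := by
    refine csSup_le ⟨_, A, hA, rfl⟩ ?_
    rintro n ⟨B, hB, rfl⟩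
    exact hwc B hB
  have hw2 : N ≤ widthP (α × β) := by
    refine hNA.trans (le_csSup ⟨minUnichainCover α β, ?_⟩ ⟨A, hA, rfl⟩)
    rintro n ⟨B, hB, rfl⟩
    exact hwc B hB
  have hd1 : dk β (Fintype.card α) ≤ N := by
    refine csSup_le ⟨_, fun _ => ∅, by simp, rfl⟩ ?_
    rintro n ⟨B, hB, rfl⟩
    exact hd B hB
  have hd2 : N ≤ dk β (Fintype.card α) := by
    have hS : ∀ i, IsAntichain (· ≤ ·) {x : β | (e i, x) ∈ A} := by
      intro i x hx y hy hne hle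
      exact hA hx hy (fun h => hne (Prod.ext_iff.1 h).2) ⟨le_rfl, hle⟩
    have hle : A.ncard ≤ (⋃ i, {x : β | (e i, x) ∈ A}).ncard := by
      apply Set.ncard_le_ncard_of_injOn Prod.snd
      · rintro ⟨p, x⟩ hx
        exact Set.mem_iUnion.2 ⟨e.symm p, by simpa using hx⟩
      · rintro ⟨p, x⟩ hx ⟨q, y⟩ hy hxy
        obtain rfl : x = y := hxy
        rcases le_total p q with h | h
        · exact hA.eq hx hy ⟨h, le_rfl⟩
        · exact (hA.eq hy hx ⟨h, le_rfl⟩).symm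
    refine (hNA.trans hle).trans (le_csSup ⟨N, ?_⟩ ⟨_, hS, rfl⟩)
    rintro n ⟨B, hB, rfl⟩
    exact hd B hB
  exact ⟨by omega, by omega⟩
end

section
/- For every finite poset P and every positive integer k, there exists a partition 𝒞 of P into chains such that d_k(P) = ∑_{C∈𝒞} min(k, |C|). -/
open Finset in
/-- Egervary duality for square integer matrices. -/
theorem gk_egervary {α : Type} [Fintype α] [DecidableEq α] (w : α → α → ℤ) :
    ∃ (u v : α → ℤ) (σ : Equiv.Perm α), (∀ x y, w x y ≤ u x + v y) ∧
      ∀ x, u x + v (σ x) = w x (σ x) := by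
  classical
  -- strong induction on the gap
  have key : ∀ n : ℕ, ∀ u v : α → ℤ, (∀ x y, w x y ≤ u x + v y) →
      (∑ x, (u x + v x - w x x)).toNat = n →
      ∃ (u v : α → ℤ) (σ : Equiv.Perm α), (∀ x y, w x y ≤ u x + v y) ∧
        ∀ x, u x + v (σ x) = w x (σ x) := by
    intro n
    induction n using Nat.strong_induction_on with
    | _ n ih =>
      intro u v hc hn
      let N : α → Finset α := fun x => univ.filter (fun y => u x + v y = w x y)
      by_cases hall : ∀ s : Finset α, #s ≤ #(s.biUnion N)
      · obtain ⟨f, hf, hfN⟩ := (Finset.all_card_le_biUnion_card_iff_exists_injective N).1 hall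
        refine ⟨u, v, Equiv.ofBijective f (Finite.injective_iff_bijective.1 hf), hc, ?_⟩
        intro x
        have := hfN x
        simpa [N] using this
      · push Not at hall
        obtain ⟨s, hs⟩ := hall
        let T := s.biUnion N
        let u' : α → ℤ := fun x => u x - if x ∈ s then 1 else 0
        let v' : α → ℤ := fun x => v x + if x ∈ T then 1 else 0
        have hc' : ∀ x y, w x y ≤ u' x + v' y := by
          intro x y
          have h := hc x y
          by_cases hx : x ∈ s
          · by_cases hy : y ∈ T
            · simp only [u', v', hx, hy, if_true]; linarith
            · have hne : u x + v y ≠ w x y := by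
                intro he
                apply hy
                exact Finset.mem_biUnion.2 ⟨x, hx, by simp [N, he]⟩
              have : w x y < u x + v y := lt_of_le_of_ne h (Ne.symm hne)
              simp only [u', v', hx, hy, if_true, if_false]; linarith
          · by_cases hy : y ∈ T
            · simp only [u', v', hx, hy, if_true, if_false]; linarith
            · simp only [u', v', hx, hy, if_false]; linarith
        have hsum : ∑ x, (u' x + v' x - w x x) = ∑ x, (u x + v x - w x x) - #s + #T := by
          have h1 : (∑ x, (if x ∈ s then (1 : ℤ) else 0)) = #s := by simp
          have h2 : (∑ x, (if x ∈ T then (1 : ℤ) else 0)) = #T := by simp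
          rw [← h1, ← h2, ← Finset.sum_sub_distrib, ← Finset.sum_add_distrib]
          apply Finset.sum_congr rfl
          intro x _
          simp only [u', v']; ring
        have hpos : 0 ≤ ∑ x, (u' x + v' x - w x x) :=
          Finset.sum_nonneg (fun x _ => by linarith [hc' x x])
        have hlt : (#T : ℤ) < #s := by exact_mod_cast hs
        exact ih _ (by omega) u' v' hc' rfl
  let M : ℤ := ∑ x, ∑ y, |w x y|
  refine key _ (fun _ => M) (fun _ => 0) ?_ rfl
  intro x y
  have h1 : |w x y| ≤ ∑ y, |w x y| :=
    Finset.single_le_sum (f := fun y => |w x y|) (fun _ _ => abs_nonneg _) (mem_univ y)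
  have h2 : ∑ y, |w x y| ≤ M :=
    Finset.single_le_sum (f := fun x => ∑ y, |w x y|)
      (fun _ _ => Finset.sum_nonneg (fun _ _ => abs_nonneg _)) (mem_univ x)
  have := le_abs_self (w x y)
  simp only [add_zero]
  linarith

/-- The chain partition obtained from a permutation. -/
theorem gk_partition {α : Type} [Fintype α] [DecidableEq α] [PartialOrder α]
    (σ : Equiv.Perm α) :
    ∃ t : α → α, (∀ x, ¬ t x < σ (t x)) ∧ (∀ x, ¬ x < σ x → t x = x) ∧
      (∀ x y, t x = t y → x ≤ y ∨ y ≤ x) ∧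
      (∀ x, σ (t x) = t x → t x = x) := by
  classical
  let r : α → α → Prop := fun x y => y = σ x ∧ x < y
  have ht : ∀ x, ∃ e, Relation.ReflTransGen r x e ∧ ¬ e < σ e := by
    intro x
    induction x using (wellFounded_gt (α := α)).induction with
    | _ x ih =>
      by_cases hx : x < σ x
      · obtain ⟨e, he, he'⟩ := ih _ hx
        exact ⟨e, Relation.ReflTransGen.head ⟨rfl, hx⟩ he, he'⟩
      · exact ⟨x, Relation.ReflTransGen.refl, hx⟩
  have hle : ∀ x y, Relation.ReflTransGen r x y → x ≤ y := by
    intro x y h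
    induction h with
    | refl => exact le_rfl
    | tail _ h ih => exact ih.trans h.2.le
  have hcomp : ∀ x e y, Relation.ReflTransGen r x e → Relation.ReflTransGen r y e →
      Relation.ReflTransGen r x y ∨ Relation.ReflTransGen r y x := by
    intro x e y hx hy
    induction hx using Relation.ReflTransGen.head_induction_on with
    | refl => exact Or.inr hy
    | head h _ ih =>
      rename_i a c _
      rcases ih with h1 | h1
      · exact Or.inl (h1.head h)
      · rcases Relation.ReflTransGen.cases_tail h1 with h2 | ⟨z, hz, hz'⟩
        · subst h2
          exact Or.inl (Relation.ReflTransGen.single h)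
        · have : z = a := σ.injective (hz'.1.symm.trans h.1)
          subst this
          exact Or.inr hz
  choose t h1 h2 using ht
  refine ⟨t, h2, ?_, ?_, ?_⟩
  · intro x hx
    rcases Relation.ReflTransGen.cases_head (h1 x) with h | ⟨c, hc, _⟩
    · exact h.symm
    · exact absurd (hc.1 ▸ hc.2) hx
  · intro x y h
    have hy := h1 y
    rw [← h] at hy
    exact (hcomp x _ y (h1 x) hy).imp (hle _ _) (hle _ _)
  · intro x hx
    rcases Relation.ReflTransGen.cases_tail (h1 x) with h | ⟨c, _, hc⟩
    · exact h
    · have : c = t x := σ.injective (hc.1.symm.trans hx.symm)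
      exact absurd hc.2 (by rw [this]; exact lt_irrefl _)

/-- Weak duality. -/
theorem gk_weak {α : Type} [Fintype α] [PartialOrder α] (k : ℕ) (𝒞 : Finset (Set α))
    (hch : ∀ C ∈ 𝒞, IsChain (· ≤ ·) C) (hcov : (⋃ C ∈ 𝒞, C) = Set.univ)
    (A : Fin k → Set α) (hA : ∀ i, IsAntichain (· ≤ ·) (A i)) :
    (⋃ i, A i).ncard ≤ ∑ C ∈ 𝒞, min k C.ncard := by
  classical
  have h1 : (⋃ i, A i) = ⋃ C ∈ 𝒞, (C ∩ ⋃ i, A i) := by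
    rw [← Set.iUnion₂_inter, hcov, Set.univ_inter]
  rw [h1]
  refine (Finset.set_ncard_biUnion_le 𝒞 _).trans (Finset.sum_le_sum ?_)
  intro C hC
  refine le_min ?_ (Set.ncard_le_ncard Set.inter_subset_left (Set.toFinite _))
  rw [Set.inter_iUnion]
  have h2 : (⋃ i, C ∩ A i) = ⋃ i ∈ (Finset.univ : Finset (Fin k)), C ∩ A i := by simp
  rw [h2]
  refine (Finset.set_ncard_biUnion_le _ _).trans ?_
  have : ∀ i ∈ (Finset.univ : Finset (Fin k)), (C ∩ A i).ncard ≤ 1 := by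
    intro i _
    rw [Set.ncard_le_one (Set.toFinite _)]
    rintro a ⟨ha, ha'⟩ b ⟨hb, hb'⟩
    by_contra hne
    rcases hch C hC ha hb hne with h | h
    · exact hA i ha' hb' hne h
    · exact hA i hb' ha' (Ne.symm hne) h
  simpa using Finset.sum_le_sum this

theorem greene_kleitman
    (α : Type) [Fintype α] [PartialOrder α] (k : ℕ) (hk : 0 < k) :
    ∃ 𝒞 : Finset (Set α),
      (∀ C ∈ 𝒞, IsChain (· ≤ ·) C) ∧
      (∀ C ∈ 𝒞, C.Nonempty) ∧
      (∀ C ∈ 𝒞, ∀ C' ∈ 𝒞, C ≠ C' → Disjoint C C') ∧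
      (⋃ C ∈ 𝒞, C) = Set.univ ∧
      dk α k = ∑ C ∈ 𝒞, min k C.ncard := by
  classical
  let w : α → α → ℤ := fun x y => if x < y then (k : ℤ) else if x = y then (k : ℤ) - 1 else 0
  have hw0 : ∀ x y, 0 ≤ w x y := by
    intro x y
    simp only [w]; split_ifs <;> omega
  obtain ⟨u, v, σ, hc, htight⟩ := gk_egervary w
  obtain ⟨t, ht1, ht2, ht3, ht4⟩ := gk_partition σ
  -- normalisation
  have hshift : ∃ c : ℤ, (∀ y, c ≤ v y) ∧ ∀ x, 0 ≤ u x + c := by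
    rcases isEmpty_or_nonempty α with h | h
    · exact ⟨0, fun y => h.elim y, fun y => h.elim y⟩
    · obtain ⟨y0, hy0⟩ := Finite.exists_min v
      exact ⟨v y0, hy0, fun x => (hw0 x y0).trans (hc x y0)⟩
  obtain ⟨c, hcv, hcu⟩ := hshift
  let E : Finset α := Finset.univ.filter (fun e => ¬ e < σ e)
  let F : α → Set α := fun e => {y | t y = e}
  have hE : ∀ e ∈ E, t e = e := fun e he => ht2 e (by simpa [E] using he)
  have hch : ∀ C ∈ E.image F, IsChain (· ≤ ·) C := by
    intro C hC
    obtain ⟨e, _, rfl⟩ := Finset.mem_image.1 hC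
    intro x hx y hy _
    exact ht3 x y (Eq.trans hx (Eq.symm hy))
  have hcov : (⋃ C ∈ E.image F, C) = Set.univ := by
    apply Set.eq_univ_of_forall
    intro x
    refine Set.mem_iUnion₂.2 ⟨F (t x), Finset.mem_image_of_mem F ?_, rfl⟩
    simpa [E] using ht1 x
  refine ⟨E.image F, hch, ?_, ?_, hcov, ?_⟩
  · intro C hC
    obtain ⟨e, he, rfl⟩ := Finset.mem_image.1 hC
    exact ⟨e, hE e he⟩
  · intro C hC C' hC' hne
    obtain ⟨e, he, rfl⟩ := Finset.mem_image.1 hC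
    obtain ⟨e', he', rfl⟩ := Finset.mem_image.1 hC'
    rw [Set.disjoint_left]
    intro x hx hx'
    have : e = e' := (Eq.symm hx).trans hx'
    exact hne (by rw [this])
  apply le_antisymm
  · apply csSup_le
    · exact ⟨_, fun _ => ∅, fun _ => by simp, rfl⟩
    · rintro n ⟨A, hA, rfl⟩
      exact gk_weak k _ hch hcov A hA
  · let A : Fin k → Set α := fun i => {x | u x + v x = (k : ℤ) - 1 ∧ u x + c = (i : ℕ)}
    have hA : ∀ i, IsAntichain (· ≤ ·) (A i) := by
      intro i x hx y hy hne hxy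
      have hlt : x < y := lt_of_le_of_ne hxy hne
      have h := hc x y
      simp only [w, hlt, if_true] at h
      have h1 := hx.2
      have h2 := hy.2
      have h3 := hy.1
      linarith
    have hU : (⋃ i, A i) = ((Finset.univ.filter (fun x => u x + v x = (k : ℤ) - 1) : Finset α) : Set α) := by
      ext x
      simp only [Set.mem_iUnion, Finset.coe_filter, Finset.mem_univ, true_and, Set.mem_ofPred_eq, A]
      constructor
      · rintro ⟨i, h, _⟩; exact h
      · intro h
        have h1 := hcv x
        have h2 := hcu x
        exact ⟨⟨(u x + c).toNat, by omega⟩, h, by simp [h2]⟩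
    have hmem : (⋃ i, A i).ncard ≤ dk α k := by
      apply le_csSup
      · refine ⟨Fintype.card α, ?_⟩
        rintro n ⟨B, _, rfl⟩
        rw [← Nat.card_eq_fintype_card]
        exact Set.ncard_le_card _
      · exact ⟨A, hA, rfl⟩
    refine le_trans ?_ hmem
    rw [hU, Set.ncard_coe_finset]
    have hs1 : ((∑ C ∈ E.image F, min k C.ncard : ℕ) : ℤ) ≤ ∑ x, ((k : ℤ) - w x (σ x)) := by
      rw [Finset.sum_image]
      · push_cast
        rw [← Finset.sum_subset (Finset.subset_univ E)]
        · apply Finset.sum_le_sum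
          intro e he
          have hne : ¬ e < σ e := by simpa [E] using he
          by_cases hfix : e = σ e
          · have : (F e).ncard ≤ 1 := by
              rw [Set.ncard_le_one (Set.toFinite _)]
              have : ∀ a ∈ F e, a = e := by
                intro a ha
                have ha' : t a = e := ha
                have := ht4 a (by rw [ha']; exact hfix.symm)
                rw [← this, ha']
              intro a ha b hb
              rw [this a ha, this b hb]
            have hw : w e (σ e) = k - 1 := by
              simp only [w, hne, if_false]; rw [if_pos hfix]
            rw [hw]
            refine (min_le_right _ _).trans ?_
            have : ((F e).ncard : ℤ) ≤ 1 := by exact_mod_cast this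
            linarith
          · have hw : w e (σ e) = 0 := by
              simp only [w, hne, hfix, if_false]
            rw [hw, sub_zero]
            exact min_le_left _ _
        · intro x _ hx
          have : x < σ x := by simpa [E] using hx
          simp [w, this]
      · intro e he e' he' h
        have h1 : e ∈ F e := hE e he
        have h : F e = F e' := h
        rw [h] at h1
        exact (hE e he).symm.trans h1
    have hs2 : ∑ x, ((k : ℤ) - w x (σ x)) = ∑ x, ((k : ℤ) - (u x + v x)) := by
      simp only [← htight, Finset.sum_sub_distrib, Finset.sum_add_distrib]
      rw [Equiv.sum_comp σ v]
    have hs3 : ∑ x, ((k : ℤ) - (u x + v x)) ≤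
        ((Finset.univ.filter (fun x => u x + v x = (k : ℤ) - 1)).card : ℤ) := by
      rw [Finset.card_filter]
      push_cast
      apply Finset.sum_le_sum
      intro x _
      have h := hc x x
      simp only [w, lt_irrefl, if_false, if_true] at h
      split_ifs with h1 <;> omega
    have := (hs1.trans hs2.le).trans hs3
    exact_mod_cast this
end

section
/- For every finite poset P there exists a non-increasing sequence of positive integers λ_1 ≥ λ_2 ≥ … ≥ λ_{w(P)} summing to |P| such that for every k, c_k(P) = λ_1 + … + λ_k and d_k(P) = μ_1 + … + μ_k, where μ is the conjugate partition defined by μ_i = #{j : λ_j ≥ i}. -/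
namespace GreeneProof

open Finset

section bounds
variable {α : Type} [Fintype α] [PartialOrder α]

lemma bddAbove_ncard (p : Set α → Prop) :
    BddAbove {n | ∃ S : Set α, p S ∧ S.ncard = n} := by
  refine ⟨Fintype.card α, ?_⟩
  rintro n ⟨S, -, rfl⟩
  rw [← Nat.card_eq_fintype_card]
  exact Set.ncard_le_card S

lemma bdd_ck (k : ℕ) : BddAbove {n | ∃ C : Fin k → Set α,
    (∀ i, IsChain (· ≤ ·) (C i)) ∧ (⋃ i, C i).ncard = n} := by
  refine ⟨Fintype.card α, ?_⟩
  rintro n ⟨S, -, rfl⟩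
  rw [← Nat.card_eq_fintype_card]
  exact Set.ncard_le_card _

lemma bdd_dk (k : ℕ) : BddAbove {n | ∃ C : Fin k → Set α,
    (∀ i, IsAntichain (· ≤ ·) (C i)) ∧ (⋃ i, C i).ncard = n} := by
  refine ⟨Fintype.card α, ?_⟩
  rintro n ⟨S, -, rfl⟩
  rw [← Nat.card_eq_fintype_card]
  exact Set.ncard_le_card _

lemma le_ck {k : ℕ} (C : Fin k → Set α) (h : ∀ i, IsChain (· ≤ ·) (C i)) :
    (⋃ i, C i).ncard ≤ ck α k := le_csSup (bdd_ck k) ⟨C, h, rfl⟩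

lemma le_dk {k : ℕ} (C : Fin k → Set α) (h : ∀ i, IsAntichain (· ≤ ·) (C i)) :
    (⋃ i, C i).ncard ≤ dk α k := le_csSup (bdd_dk k) ⟨C, h, rfl⟩

lemma exists_ck (k : ℕ) : ∃ C : Fin k → Set α,
    (∀ i, IsChain (· ≤ ·) (C i)) ∧ (⋃ i, C i).ncard = ck α k :=
  Nat.sSup_mem (s := {n | ∃ C : Fin k → Set α,
    (∀ i, IsChain (· ≤ ·) (C i)) ∧ (⋃ i, C i).ncard = n})
    ⟨_, fun _ => ∅, fun _ => IsChain.empty, rfl⟩ (bdd_ck k)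

lemma exists_dk (k : ℕ) : ∃ C : Fin k → Set α,
    (∀ i, IsAntichain (· ≤ ·) (C i)) ∧ (⋃ i, C i).ncard = dk α k :=
  Nat.sSup_mem (s := {n | ∃ C : Fin k → Set α,
    (∀ i, IsAntichain (· ≤ ·) (C i)) ∧ (⋃ i, C i).ncard = n})
    ⟨_, fun _ => ∅, fun _ => by simp, rfl⟩ (bdd_dk k)

/-- weak duality -/
lemma weak (k l : ℕ) : ck α k + dk α l ≤ Fintype.card α + k * l := by
  classical
  obtain ⟨C, hC, h1⟩ := exists_ck (α := α) k
  obtain ⟨A, hA, h2⟩ := exists_dk (α := α) l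
  rw [← h1, ← h2, ← Set.ncard_union_add_ncard_inter]
  refine add_le_add ?_ ?_
  · rw [← Nat.card_eq_fintype_card]
    exact Set.ncard_le_card _
  · have hinj : ∀ p : Fin k × Fin l, (C p.1 ∩ A p.2).ncard ≤ 1 := by
      rintro ⟨i, j⟩
      rw [Set.ncard_le_one_iff]
      intro a b ha hb
      by_contra hab
      rcases hC i ha.1 hb.1 hab with h | h
      · exact hA j ha.2 hb.2 hab h
      · exact hA j hb.2 ha.2 (Ne.symm hab) h
    have hsub : (⋃ i, C i) ∩ (⋃ j, A j) ⊆
        ⋃ p ∈ (Finset.univ : Finset (Fin k × Fin l)), (C p.1 ∩ A p.2) := by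
      rintro x ⟨hx, hy⟩
      obtain ⟨i, hi⟩ := Set.mem_iUnion.1 hx
      obtain ⟨j, hj⟩ := Set.mem_iUnion.1 hy
      simp only [Finset.mem_univ, Set.iUnion_true, Set.mem_iUnion]
      exact ⟨(i, j), hi, hj⟩
    calc _ ≤ _ := Set.ncard_le_ncard hsub
      _ ≤ ∑ p : Fin k × Fin l, (C p.1 ∩ A p.2).ncard := Finset.set_ncard_biUnion_le _ _
      _ ≤ ∑ p : Fin k × Fin l, 1 := Finset.sum_le_sum fun p _ => hinj p
      _ = k * l := by simp

lemma widthP_eq : widthP α = dk α 1 := by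
  unfold widthP dk
  congr 1
  ext n
  constructor
  · rintro ⟨A, h, rfl⟩
    exact ⟨fun _ => A, fun _ => h, by rw [Set.iUnion_const]⟩
  · rintro ⟨A, h, rfl⟩
    exact ⟨A 0, h 0, by congr 1; ext; simp⟩

lemma ck_zero : ck α 0 = 0 := by
  obtain ⟨C, -, h⟩ := exists_ck (α := α) 0
  rw [← h]; simp

lemma dk_zero : dk α 0 = 0 := by
  obtain ⟨C, -, h⟩ := exists_dk (α := α) 0
  rw [← h]; simp

lemma ck_mono : Monotone (ck α) := by
  refine monotone_nat_of_le_succ fun k => ?_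
  obtain ⟨C, hC, h⟩ := exists_ck (α := α) k
  rw [← h]
  refine le_trans (Set.ncard_le_ncard ?_)
    (le_ck (Fin.snoc (α := fun _ => Set α) C ∅) ?_)
  · intro x hx
    obtain ⟨i, hi⟩ := Set.mem_iUnion.1 hx
    exact Set.mem_iUnion.2 ⟨i.castSucc, by simpa using hi⟩
  · intro i
    refine Fin.lastCases ?_ (fun i => ?_) i
    · simp
    · simpa using hC i

lemma dk_mono : Monotone (dk α) := by
  refine monotone_nat_of_le_succ fun k => ?_
  obtain ⟨C, hC, h⟩ := exists_dk (α := α) k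
  rw [← h]
  refine le_trans (Set.ncard_le_ncard ?_)
    (le_dk (Fin.snoc (α := fun _ => Set α) C ∅) ?_)
  · intro x hx
    obtain ⟨i, hi⟩ := Set.mem_iUnion.1 hx
    exact Set.mem_iUnion.2 ⟨i.castSucc, by simpa using hi⟩
  · intro i
    refine Fin.lastCases ?_ (fun i => ?_) i
    · simp
    · simpa using hC i

lemma ck_le (k : ℕ) : ck α k ≤ Fintype.card α := by
  have := weak (α := α) k 0
  rw [dk_zero] at this; simpa using this

lemma dk_le (k : ℕ) : dk α k ≤ Fintype.card α := by
  have := weak (α := α) 0 k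
  rw [ck_zero] at this; simpa using this

end bounds

section flow
variable {α : Type} [PartialOrder α]

/-- Tight arcs with respect to a potential. -/
def Tight (f g : α → ℤ) (l : ℤ) {m : ℕ} : α ⊕ Fin m → α ⊕ Fin m → Prop
  | .inl u, .inl v => (u < v ∧ g u = f v) ∨ (u = v ∧ g u = f v + 1)
  | .inl u, .inr _ => g u = l
  | .inr _, .inl v => f v = 0
  | .inr _, .inr _ => l = 0

/-- Feasible potentials. -/
structure Feas (f g : α → ℤ) (l : ℤ) : Prop where
  lt : ∀ u v, u < v → g u ≤ f v
  loop : ∀ v, g v ≤ f v + 1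
  nonneg : ∀ v, 0 ≤ f v
  le : ∀ v, g v ≤ l

/-- There is a potential of height `l` and a tight flow of value `k`. -/
def State (α : Type) [PartialOrder α] (k l : ℕ) : Prop :=
  ∃ f g : α → ℤ, Feas f g l ∧ ∃ σ : Equiv.Perm (α ⊕ Fin k), ∀ x, Tight f g l x (σ x)

/-- `v` is the `m`-th element of the `i`-th chain. -/
def Rch {k : ℕ} (σ : Equiv.Perm (α ⊕ Fin k)) (i : Fin k) : ℕ → α → Prop
  | 0, v => σ (.inr i) = .inl v
  | m + 1, v => ∃ u, Rch σ i m u ∧ σ (.inl u) = .inl v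

lemma Rch.unique {k : ℕ} {σ : Equiv.Perm (α ⊕ Fin k)} {i : Fin k} :
    ∀ {m : ℕ} {u v : α}, Rch σ i m u → Rch σ i m v → u = v
  | 0, u, v, hu, hv => by
      have := hu.symm.trans hv
      simpa using this
  | m + 1, u, v, ⟨u', hu', hu⟩, ⟨v', hv', hv⟩ => by
      have := Rch.unique hu' hv'
      subst this
      have := hu.symm.trans hv
      simpa using this

lemma Rch.mono {k : ℕ} {σ : Equiv.Perm (α ⊕ Fin k)}
    (hσ : ∀ u v, σ (.inl u) = .inl v → u ≤ v) {i : Fin k} {m : ℕ} {u : α} (hu : Rch σ i m u) :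
    ∀ (d : ℕ) {v : α}, Rch σ i (m + d) v → u ≤ v
  | 0, v, hv => (Rch.unique hu hv).le
  | d + 1, v, ⟨v', hv', h⟩ => (Rch.mono hσ hu d hv').trans (hσ _ _ h)

variable [Fintype α]

lemma ck_of_perm {k : ℕ} (σ : Equiv.Perm (α ⊕ Fin k))
    (hσ : ∀ u v, σ (.inl u) = .inl v → u ≤ v) :
    {v : α | σ (.inl v) ≠ .inl v}.ncard ≤ ck α k := by
  refine le_trans (Set.ncard_le_ncard ?_) (le_ck (fun i => {v | ∃ m, Rch σ i m v}) ?_)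
  · intro v
    induction v using WellFoundedLT.induction with
    | ind v ih =>
      intro hv
      rcases hx : σ.symm (.inl v) with u | i
      · have hu : σ (.inl u) = .inl v := by rw [← hx]; simp
        have hne : u ≠ v := by
          rintro rfl
          exact hv hu
        have hlt : u < v := lt_of_le_of_ne (hσ _ _ hu) hne
        have := ih u hlt (by
          intro h
          rw [hu] at h
          exact hne (by simpa using h.symm))
        obtain ⟨i, m, hm⟩ := Set.mem_iUnion.1 this
        exact Set.mem_iUnion.2 ⟨i, m + 1, u, hm, hu⟩
      · have hu : σ (.inr i) = .inl v := by rw [← hx]; simp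
        exact Set.mem_iUnion.2 ⟨i, 0, hu⟩
  · rintro i u ⟨m, hm⟩ v ⟨m', hm'⟩ -
    rcases le_total m m' with h | h
    · obtain ⟨d, rfl⟩ := Nat.exists_eq_add_of_le h
      exact Or.inl (Rch.mono hσ hm d hm')
    · obtain ⟨d, rfl⟩ := Nat.exists_eq_add_of_le h
      exact Or.inr (Rch.mono hσ hm' d hm)

lemma dk_of_feas {f g : α → ℤ} {l : ℕ} (h : Feas f g l) :
    ∑ v, (g v - f v) ≤ (dk α l : ℤ) := by
  classical
  have h1 : {v : α | g v = f v + 1}.ncard ≤ dk α l := by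
    refine le_trans (Set.ncard_le_ncard ?_)
      (le_dk (fun j : Fin l => {v | f v = (j : ℕ) ∧ g v = f v + 1}) ?_)
    · intro v hv
      have hv : g v = f v + 1 := hv
      have h2 := h.nonneg v
      have h3 := h.le v
      refine Set.mem_iUnion.2 ⟨⟨(f v).toNat, by omega⟩, ?_, hv⟩
      simp [h2]
    · rintro j u ⟨hu, hu'⟩ v ⟨hv, hv'⟩ hne hle
      have := h.lt u v (lt_of_le_of_ne hle hne)
      omega
  refine le_trans ?_ (Int.ofNat_le.2 h1)
  have h2 : {v : α | g v = f v + 1}.ncard = (univ.filter fun v => g v = f v + 1).card := by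
    rw [← Set.ncard_coe_finset]; simp
  rw [h2, Finset.card_filter]
  push_cast
  refine Finset.sum_le_sum fun v _ => ?_
  have := h.loop v
  split_ifs <;> omega

lemma State.tight {k l : ℕ} (h : State α k l) :
    ck α k + dk α l = Fintype.card α + k * l := by
  classical
  refine le_antisymm (weak k l) ?_
  obtain ⟨f, g, hfg, σ, hσ⟩ := h
  have h1 := ck_of_perm σ (by
    intro u v huv
    have := hσ (.inl u)
    rw [huv] at this
    rcases this with h | h
    · exact h.1.le
    · exact h.1.le)
  have h2 := dk_of_feas hfg
  have hc : {v : α | σ (.inl v) ≠ .inl v}.ncard + 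
      (univ.filter fun v : α => σ (.inl v) = .inl v).card = Fintype.card α := by
    have : {v : α | σ (.inl v) ≠ .inl v}.ncard
        = (univ.filter fun v : α => ¬ σ (.inl v) = .inl v).card := by
      rw [← Set.ncard_coe_finset]; simp
    rw [this, add_comm, Finset.card_filter_add_card_filter_not]
    rfl
  have hs : ∑ v, (g v - f v) = ((univ.filter fun v : α => σ (.inl v) = .inl v).card : ℤ) + k * l := by
    have e1 : ∑ x : α ⊕ Fin k, (Sum.elim g (fun _ => 0) x - Sum.elim f (fun _ => (l : ℤ)) (σ x))
        = ∑ x : α ⊕ Fin k, Sum.elim (fun v => if σ (.inl v) = .inl v then (1 : ℤ) else 0)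
          (fun _ => 0) x := by
      refine Finset.sum_congr rfl fun x _ => ?_
      have hx := hσ x
      rcases x with u | i
      · rcases hy : σ (.inl u) with v | j
        · rw [hy] at hx
          rcases hx with ⟨h, h'⟩ | ⟨h, h'⟩
          · simp [hy, h', h.ne']
          · subst h
            simp [hy, h']
        · rw [hy] at hx
          have hx : g u = l := hx
          simp [hy, hx]
      · rcases hy : σ (.inr i) with v | j
        · rw [hy] at hx
          have hx : f v = 0 := hx
          simp [hx]
        · rw [hy] at hx
          have hx : (l : ℤ) = 0 := hx
          simp [hx]
    rw [Finset.sum_sub_distrib, Equiv.sum_comp σ (Sum.elim f (fun _ => (l : ℤ)))] at e1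
    simp only [Fintype.sum_sum_type, Sum.elim_inl, Sum.elim_inr, Finset.sum_const] at e1
    rw [Finset.sum_sub_distrib, Finset.card_filter]
    simp at e1 ⊢
    linarith
  zify at *
  linarith

lemma State.le_card {k l : ℕ} (h : State α k (l + 1)) : k ≤ Fintype.card α := by
  obtain ⟨f, g, hfg, σ, hσ⟩ := h
  have : ∀ i, ∃ v, σ (.inr i) = .inl v := by
    intro i
    have hx := hσ (.inr i)
    rcases hy : σ (.inr i) with v | j
    · exact ⟨v, rfl⟩
    · rw [hy] at hx
      have hx : ((l + 1 : ℕ) : ℤ) = 0 := hx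
      omega
  choose c hc using this
  have hinj : Function.Injective c := by
    intro i j hij
    have := (hc i).trans ((congrArg _ hij).trans (hc j).symm)
    simpa using this
  simpa using Fintype.card_le_of_injective c hinj

lemma State.init : State α 0 (Fintype.card α) := by
  classical
  refine ⟨fun v => ((univ.filter fun u => u < v).card : ℤ),
    fun v => ((univ.filter fun u => u < v).card : ℤ) + 1, ⟨?_, fun v => le_rfl, fun v => by positivity, ?_⟩, 1, ?_⟩
  · intro u v huv
    have : (univ.filter fun w => w < u).card < (univ.filter fun w => w < v).card := by
      apply Finset.card_lt_card
      rw [Finset.ssubset_iff_of_subset]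
      · exact ⟨u, by simpa using huv, by simp⟩
      · intro w hw
        simp at hw ⊢
        exact hw.trans huv
    omega
  · intro v
    have : (univ.filter fun w => w < v).card < Fintype.card α := by
      apply Finset.card_lt_card
      rw [Finset.ssubset_iff_of_subset (Finset.subset_univ _)]
      exact ⟨v, by simp, by simp⟩
    omega
  · rintro (v | i)
    · exact Or.inr ⟨rfl, rfl⟩
    · exact i.elim0

lemma State.step {k l : ℕ} (h : State α k (l + 1)) : State α (k + 1) (l + 1) ∨ State α k l := by
  classical
  obtain ⟨f, g, hfg, σ, hσ⟩ := h
  by_cases hH : ∀ s : Finset (α ⊕ Fin (k + 1)),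
      s.card ≤ (s.biUnion fun x => univ.filter fun y => Tight f g ((l + 1 : ℕ) : ℤ) x y).card
  · left
    obtain ⟨τ, hτ, hτ'⟩ := (Finset.all_card_le_biUnion_card_iff_exists_injective _).1 hH
    refine ⟨f, g, hfg, Equiv.ofBijective τ (Finite.injective_iff_bijective.1 hτ), fun x => ?_⟩
    have := hτ' x
    simpa using this
  · right
    push Not at hH
    obtain ⟨s, hs⟩ := hH
    set N := s.biUnion fun x => univ.filter fun y => Tight f g ((l + 1 : ℕ) : ℤ) x y with hN
    have memN : ∀ y, y ∈ N ↔ ∃ x ∈ s, Tight f g ((l + 1 : ℕ) : ℤ) x y := by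
      intro y; simp [hN]
    -- the embedding
    let e : α ⊕ Fin k → α ⊕ Fin (k + 1) := Sum.map id Fin.castSucc
    have he : Function.Injective e := by
      rintro (a | a) (b | b) hab <;> simp [e] at hab ⊢ <;> exact hab
    have hTe : ∀ x y, Tight f g ((l + 1 : ℕ) : ℤ) (e x) (e y) ↔ Tight f g ((l + 1 : ℕ) : ℤ) x y := by
      rintro (a | a) (b | b) <;> exact Iff.rfl
    let SP : Finset α := univ.filter fun v => Sum.inl v ∈ s
    -- some copy lies in s
    have hz : ∃ i, Sum.inr i ∈ s := by
      by_contra hz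
      push Not at hz
      have h1 : s.card ≤ N.card := by
        have hsub : ((SP.image fun v => e (σ (.inl v)))) ⊆ N := by
          intro y hy
          obtain ⟨v, hv, rfl⟩ := Finset.mem_image.1 hy
          rw [memN]
          refine ⟨.inl v, by simpa [SP] using hv, ?_⟩
          exact (hTe (.inl v) _).2 (hσ (.inl v))
        have hse : s = SP.image Sum.inl := by
          ext x
          rcases x with v | i
          · simp [SP]
          · simp [hz i]
        calc s.card = (SP.image (Sum.inl : α → α ⊕ Fin (k+1))).card := by rw [← hse]
          _ = SP.card := Finset.card_image_of_injective _ Sum.inl_injective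
          _ = (SP.image fun v => e (σ (.inl v))).card :=
            (Finset.card_image_of_injective _
              (he.comp (σ.injective.comp Sum.inl_injective))).symm
          _ ≤ N.card := Finset.card_le_card hsub
      omega
    obtain ⟨i₀, hi₀⟩ := hz
    let S' : Finset (α ⊕ Fin k) := SP.disjSum univ
    have hS'card : S'.card = SP.card + k := by simp [S']
    have hscard : s.card ≤ SP.card + (k + 1) := by
      have : s ⊆ SP.disjSum univ := by
        rintro (v | i) hx
        · simpa [SP] using hx
        · simp
      simpa using Finset.card_le_card this
    have hsub : S'.image (fun x => e (σ x)) ⊆ N := by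
      intro y hy
      obtain ⟨x, hx, rfl⟩ := Finset.mem_image.1 hy
      rw [memN]
      have ht := (hTe x (σ x)).2 (hσ x)
      rcases x with v | i
      · exact ⟨.inl v, by simpa [S', SP] using hx, ht⟩
      · refine ⟨.inr i₀, hi₀, ?_⟩
        revert ht
        generalize e (σ (Sum.inr i)) = y
        rcases y with y | y <;> exact id
    have hNeq : S'.image (fun x => e (σ x)) = N := by
      refine Finset.eq_of_subset_of_card_le hsub ?_
      rw [Finset.card_image_of_injective S' (f := fun x => e (σ x)) (he.comp σ.injective)]
      omega
    have hlast : Sum.inr (Fin.last k) ∉ N := by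
      rw [← hNeq]
      intro h
      obtain ⟨x, -, hx⟩ := Finset.mem_image.1 h
      rcases hy : σ x with v | j
      · simp [e, hy] at hx
      · simp [e, hy] at hx

    have hgS : ∀ u, Sum.inl u ∈ s → g u ≠ ((l + 1 : ℕ) : ℤ) := by
      intro u hu hg
      exact hlast ((memN _).2 ⟨.inl u, hu, hg⟩)
    have hiff : ∀ x, x ∈ S' ↔ e (σ x) ∈ N := by
      intro x
      rw [← hNeq, Finset.mem_image]
      constructor
      · intro h; exact ⟨x, h, rfl⟩
      · rintro ⟨x', h, h'⟩
        rwa [← (he.comp σ.injective) h']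
    have hnoinr : ∀ j : Fin (k+1), Sum.inr j ∉ N := by
      intro j hj
      obtain ⟨x, hx, ht⟩ := (memN _).1 hj
      refine hlast ((memN _).2 ⟨x, hx, ?_⟩)
      rcases x with x | x <;> exact ht
    refine ⟨fun v => if (Sum.inl v : α ⊕ Fin (k+1)) ∈ N then f v else f v - 1,
      fun v => if (Sum.inl v : α ⊕ Fin (k+1)) ∈ s then g v else g v - 1,
      ⟨?_, ?_, ?_, ?_⟩, σ, ?_⟩
    · intro u v huv
      have h1 := hfg.lt u v huv
      have h2 : Sum.inl u ∈ s → g u = f v → (Sum.inl v : α ⊕ Fin (k+1)) ∈ N := fun hu hg =>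
        (memN _).2 ⟨.inl u, hu, Or.inl ⟨huv, hg⟩⟩
      split_ifs with h3 h4 h4
      · exact h1
      · have : g u ≠ f v := fun h => h4 (h2 h3 h)
        omega
      · omega
      · omega
    · intro v
      have h1 := hfg.loop v
      have h2 : Sum.inl v ∈ s → g v = f v + 1 → (Sum.inl v : α ⊕ Fin (k+1)) ∈ N := fun hu hg =>
        (memN _).2 ⟨.inl v, hu, Or.inr ⟨rfl, hg⟩⟩
      split_ifs with h3 h4 h4
      · exact h1
      · have : g v ≠ f v + 1 := fun h => h4 (h2 h3 h)
        omega
      · omega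
      · omega
    · intro v
      have h1 := hfg.nonneg v
      have h2 : f v = 0 → (Sum.inl v : α ⊕ Fin (k+1)) ∈ N := fun hg =>
        (memN _).2 ⟨.inr i₀, hi₀, hg⟩
      split_ifs with h3
      · exact h1
      · have : f v ≠ 0 := fun h => h3 (h2 h)
        omega
    · intro v
      have h1 := hfg.le v
      split_ifs with h3
      · have := hgS v h3
        omega
      · omega
    · intro x
      have hx := hσ x
      have hi := hiff x
      rcases x with u | i
      · have hu : Sum.inl u ∈ S' ↔ (Sum.inl u : α ⊕ Fin (k+1)) ∈ s := by simp [S', SP]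
        rw [hu] at hi
        rcases hy : σ (.inl u) with v | j
        · rw [hy] at hx hi
          have hi : (Sum.inl u : α ⊕ Fin (k+1)) ∈ s ↔ (Sum.inl v : α ⊕ Fin (k+1)) ∈ N := hi
          rcases hx with ⟨h1, h2⟩ | ⟨h1, h2⟩
          · left
            refine ⟨h1, ?_⟩
            by_cases h3 : (Sum.inl u : α ⊕ Fin (k+1)) ∈ s
            · simp [h3, hi.1 h3, h2]
            · simp [h3, mt hi.2 h3, h2]
          · right
            refine ⟨h1, ?_⟩
            by_cases h3 : (Sum.inl u : α ⊕ Fin (k+1)) ∈ s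
            · simp [h3, hi.1 h3, h2]
            · simp [h3, mt hi.2 h3, h2]
        · rw [hy] at hx hi
          have hx : g u = ((l + 1 : ℕ) : ℤ) := hx
          have h3 : (Sum.inl u : α ⊕ Fin (k+1)) ∉ s := fun h => hgS u h hx
          change (if (Sum.inl u : α ⊕ Fin (k+1)) ∈ s then g u else g u - 1) = (l : ℤ)
          rw [if_neg h3]
          omega
      · have hu : Sum.inr i ∈ S' := by simp [S']
        rw [iff_true_left hu] at hi
        rcases hy : σ (.inr i) with v | j
        · rw [hy] at hx hi
          have hx : f v = 0 := hx
          have hi : (Sum.inl v : α ⊕ Fin (k+1)) ∈ N := hi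
          change (if (Sum.inl v : α ⊕ Fin (k+1)) ∈ N then f v else f v - 1) = 0
          rw [if_pos hi, hx]
        · rw [hy] at hi
          exact absurd hi (hnoinr _)

lemma exists_l (k : ℕ) : ∃ l, ck α k + dk α l = Fintype.card α + k * l := by
  have key : (∃ l, State α k l) ∨ ck α k = Fintype.card α := by
    induction k with
    | zero => exact Or.inl ⟨_, State.init⟩
    | succ k ih =>
      rcases ih with ⟨l, hl⟩ | h
      · induction l with
        | zero =>
          right
          have := hl.tight
          rw [dk_zero] at this
          have h2 := ck_mono (α := α) (Nat.le_succ k)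
          have h3 := ck_le (α := α) (k + 1)
          simp at *
          omega
        | succ l ih =>
          rcases hl.step with h | h
          · exact Or.inl ⟨_, h⟩
          · exact ih h
      · right
        have h2 := ck_mono (α := α) (Nat.le_succ k)
        have h3 := ck_le (α := α) (k + 1)
        simp at *
        omega
  rcases key with ⟨l, h⟩ | h
  · exact ⟨l, h.tight⟩
  · exact ⟨0, by rw [dk_zero, h]; simp⟩

lemma exists_state (d : ℕ) : ∀ l, l + d = Fintype.card α → ∃ k, State α k l := by
  induction d with
  | zero =>
    rintro l rfl
    exact ⟨0, State.init⟩
  | succ d ih =>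
    intro l hl
    obtain ⟨k, hk⟩ := ih (l + 1) (by omega)
    by_contra hno
    push Not at hno
    have : ∀ m, State α (k + m) (l + 1) := by
      intro m
      induction m with
      | zero => exact hk
      | succ m ihm =>
        rcases ihm.step with h | h
        · exact h
        · exact absurd h (hno _)
    have := (this (Fintype.card α + 1)).le_card
    omega

lemma exists_k (l : ℕ) : ∃ k, ck α k + dk α l = Fintype.card α + k * l := by
  rcases le_total l (Fintype.card α) with h | h
  · obtain ⟨k, hk⟩ := exists_state (α := α) (Fintype.card α - l) l (by omega)
    exact ⟨k, hk.tight⟩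
  · refine ⟨0, ?_⟩
    have h1 := (State.init (α := α)).tight
    have h2 := dk_mono (α := α) h
    have h3 := dk_le (α := α) l
    rw [ck_zero] at *
    simp at *
    omega

end flow

/-- Purely numerical part. -/
lemma numeric (n : ℕ) (c d : ℕ → ℕ) (hc0 : c 0 = 0) (hd0 : d 0 = 0) (hc : Monotone c)
    (hcn : ∀ k, c k ≤ n)
    (hw : ∀ k l, c k + d l ≤ n + k * l)
    (hl : ∀ k, ∃ l, c k + d l = n + k * l) (hk : ∀ l, ∃ k, c k + d l = n + k * l) :
    ∃ lam : ℕ → ℕ,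
      (∀ j, j < d 1 → 0 < lam j) ∧
      (∀ j, d 1 ≤ j → lam j = 0) ∧
      (∀ i j, i ≤ j → lam j ≤ lam i) ∧
      (∑ j ∈ Finset.range (d 1), lam j) = n ∧
      (∀ k, c k = ∑ j ∈ Finset.range k, lam j) ∧
      (∀ k, d k =
        ∑ i ∈ Finset.range k,
          ((Finset.range (d 1)).filter fun j => i + 1 ≤ lam j).card) := by
  let lam : ℕ → ℕ := fun j => c (j + 1) - c j
  have hlam : ∀ j, c (j + 1) = c j + lam j := fun j => by
    have := hc (Nat.le_succ j)
    simp only [lam, Nat.succ_eq_add_one] at *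
    omega
  have hsum : ∀ k, c k = ∑ j ∈ Finset.range k, lam j := by
    intro k
    induction k with
    | zero => simp [hc0]
    | succ k ih => rw [Finset.sum_range_succ, ← ih, hlam]
  have hanti : Antitone lam := by
    refine antitone_nat_of_succ_le fun j => ?_
    obtain ⟨l, h⟩ := hl (j + 1)
    have h1 := hw j l
    have h2 := hw (j + 1 + 1) l
    have h3 := hlam j
    have h4 := hlam (j + 1)
    have e1 : (j + 1) * l = j * l + l := by ring
    have e2 : (j + 1 + 1) * l = j * l + l + l := by ring
    rw [e1] at h
    rw [e2] at h2
    omega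
  obtain ⟨K, hK⟩ := hk 0
  have hK : c K = n := by simpa [hd0] using hK
  have hbig : ∀ M, K ≤ M → c M = n := fun M hM => le_antisymm (hcn M) (hK ▸ hc hM)
  have hzero : ∀ j, K ≤ j → lam j = 0 := by
    intro j hj
    have := hlam j
    rw [hbig _ hj, hbig _ (hj.trans (Nat.le_succ j))] at this
    omega
  -- formula for d
  have hd : ∀ l, d l = ∑ j ∈ Finset.range K, min (lam j) l := by
    intro l
    apply le_antisymm
    · have hex : ∃ k, k ≤ K ∧ (∀ j < k, l ≤ lam j) ∧ ∀ j, k ≤ j → j < K → lam j ≤ l := by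
        by_cases hall : ∀ j < K, l ≤ lam j
        · exact ⟨K, le_rfl, hall, fun j h1 h2 => by omega⟩
        · push Not at hall
          classical
          refine ⟨Nat.find hall, ?_, ?_, ?_⟩
          · exact (Nat.find_spec hall).1.le
          · intro j hj
            have h1 := Nat.find_min hall hj
            have h2 := (Nat.find_spec hall).1
            by_contra h3
            exact h1 ⟨by omega, by omega⟩
          · intro j hj _
            exact (hanti hj).trans (Nat.find_spec hall).2.le
      obtain ⟨k, hkK, h1, h2⟩ := hex
      have h3 := hw k l
      have h4 := Finset.sum_range_add_sum_Ico (fun j => min (lam j) l) hkK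
      have h5 := Finset.sum_range_add_sum_Ico lam hkK
      rw [← hsum, ← hsum, hK] at h5
      have h6 : ∑ j ∈ Finset.range k, min (lam j) l = k * l := by
        rw [Finset.sum_congr rfl (g := fun _ => l)]
        · simp
        · intro j hj
          exact min_eq_right (h1 j (Finset.mem_range.1 hj))
      have h7 : ∑ j ∈ Finset.Ico k K, min (lam j) l = ∑ j ∈ Finset.Ico k K, lam j := by
        refine Finset.sum_congr rfl fun j hj => ?_
        rw [Finset.mem_Ico] at hj
        exact min_eq_left (h2 j hj.1 hj.2)
      omega
    · obtain ⟨k, h⟩ := hk l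
      have hkM : k ≤ max k K := le_max_left _ _
      have h0 : ∑ j ∈ Finset.range K, min (lam j) l ≤ ∑ j ∈ Finset.range (max k K), min (lam j) l :=
        Finset.sum_le_sum_of_subset (Finset.range_mono (le_max_right _ _))
      have h4 := Finset.sum_range_add_sum_Ico (fun j => min (lam j) l) hkM
      have h5 := Finset.sum_range_add_sum_Ico lam hkM
      rw [← hsum, ← hsum, hbig _ (le_max_right _ _)] at h5
      have h6 : ∑ j ∈ Finset.range k, min (lam j) l ≤ k * l := by
        refine (Finset.sum_le_sum (g := fun _ => l) fun j _ => min_le_right _ _).trans ?_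
        simp
      have h7 : ∑ j ∈ Finset.Ico k (max k K), min (lam j) l ≤ ∑ j ∈ Finset.Ico k (max k K), lam j :=
        Finset.sum_le_sum fun j _ => min_le_left _ _
      omega
  -- support of lam
  have hsupp : ∃ w, w ≤ K ∧ (∀ j < w, 0 < lam j) ∧ ∀ j, w ≤ j → lam j = 0 := by
    classical
    have hex : ∃ j, lam j = 0 := ⟨K, hzero K le_rfl⟩
    refine ⟨Nat.find hex, Nat.find_min' hex (hzero K le_rfl), ?_, ?_⟩
    · intro j hj
      exact Nat.pos_of_ne_zero (Nat.find_min hex hj)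
    · intro j hj
      have := hanti hj
      rw [Nat.find_spec hex] at this
      omega
  obtain ⟨w, hwK, hpos, hz⟩ := hsupp
  have hd' : ∀ l, d l = ∑ j ∈ Finset.range w, min (lam j) l := by
    intro l
    rw [hd l]
    symm
    refine Finset.sum_subset (Finset.range_mono hwK) fun j _ hj => ?_
    rw [hz j (by simpa using hj)]
    simp
  have hd1 : d 1 = w := by
    rw [hd' 1, Finset.sum_congr rfl (g := fun _ => 1)]
    · simp
    · intro j hj
      exact min_eq_right (hpos j (Finset.mem_range.1 hj))
  rw [hd1]
  refine ⟨lam, hpos, hz, fun i j h => hanti h, ?_, hsum, ?_⟩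
  · rw [← hK, hsum K]
    refine Finset.sum_subset (Finset.range_mono hwK) fun j _ hj => hz j (by simpa using hj)
  · intro l
    rw [hd' l]
    simp only [Finset.card_filter]
    rw [Finset.sum_comm]
    refine Finset.sum_congr rfl fun j _ => ?_
    rw [← Finset.card_filter]
    have : (Finset.range l).filter (fun i => i + 1 ≤ lam j) = Finset.range (min (lam j) l) := by
      ext i
      simp
      omega
    rw [this, Finset.card_range]

end GreeneProof

/-- Greene's theorem: for every finite poset `P` there is a non-increasing
sequence of positive integers `λ_1 ≥ … ≥ λ_{w(P)}` summing to `|P|` (here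
`lam j` is `λ_{j+1}`, with `lam j = 0` for `j ≥ w(P)`) such that for every `k`,
`c_k(P) = λ_1 + … + λ_k` and `d_k(P) = μ_1 + … + μ_k`, where
`μ_i = #{j : λ_j ≥ i}` is the conjugate partition. -/
theorem greene_theorem (α : Type) [Fintype α] [PartialOrder α] :
    ∃ lam : ℕ → ℕ,
      (∀ j, j < widthP α → 0 < lam j) ∧
      (∀ j, widthP α ≤ j → lam j = 0) ∧
      (∀ i j, i ≤ j → lam j ≤ lam i) ∧
      (∑ j ∈ Finset.range (widthP α), lam j) = Fintype.card α ∧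
      (∀ k, ck α k = ∑ j ∈ Finset.range k, lam j) ∧
      (∀ k, dk α k =
        ∑ i ∈ Finset.range k,
          ((Finset.range (widthP α)).filter fun j => i + 1 ≤ lam j).card) := by
  rw [GreeneProof.widthP_eq]
  exact GreeneProof.numeric (Fintype.card α) (ck α) (dk α) GreeneProof.ck_zero
    GreeneProof.dk_zero GreeneProof.ck_mono GreeneProof.ck_le GreeneProof.weak
    GreeneProof.exists_l GreeneProof.exists_k
end

section
/- Let P and Q be finite posets and let 𝒞 be a covering of P by chains. Then P×Q has a unichain covering of size ∑_{C∈𝒞} d_{|C|}(Q). -/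
open Classical in
/-- Integral weighted bipartite duality, with potentials and a tight bijection. -/
theorem egervary_aux {X : Type*} [Fintype X] (E : X → X → Prop) (c : X → X → ℤ)
    (hE : ∀ x, E x x) (hc : ∀ x y, 0 ≤ c x y) :
    ∃ (u v : X → ℤ) (f : X → X), Function.Bijective f ∧
      (∀ x y, E x y → u x + v y ≤ c x y) ∧
      ∀ x, E x (f x) ∧ u x + v (f x) = c x (f x) := by
  obtain ⟨z, ⟨u, v, huv, hz⟩, hmax⟩ := Int.exists_greatest_of_bdd
    (P := fun z => ∃ u v : X → ℤ, (∀ x y, E x y → u x + v y ≤ c x y) ∧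
      ∑ x, u x + ∑ x, v x = z)
    ⟨∑ x, c x x, by
      rintro z ⟨u, v, huv, rfl⟩
      rw [← Finset.sum_add_distrib]
      exact Finset.sum_le_sum fun x _ => huv x x (hE x)⟩
    ⟨0, 0, 0, by intro x y _; simpa using hc x y, by simp⟩
  let t : X → Finset X := fun x => Finset.univ.filter fun y => E x y ∧ u x + v y = c x y
  have hall : ∀ S : Finset X, S.card ≤ (S.biUnion t).card := by
    intro S
    by_contra hlt
    push Not at hlt
    have := hmax (∑ x, (u x + if x ∈ S then 1 else 0) +
      ∑ y, (v y - if y ∈ S.biUnion t then 1 else 0))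
      ⟨fun x => u x + if x ∈ S then 1 else 0,
       fun y => v y - if y ∈ S.biUnion t then 1 else 0, by
        intro x y hxy
        have h := huv x y hxy
        by_cases hx : x ∈ S
        · by_cases hy : y ∈ S.biUnion t
          · simp only [hx, hy, if_true]; omega
          · have hne : u x + v y ≠ c x y := by
              intro he
              exact hy (Finset.mem_biUnion.2 ⟨x, hx, by simp [t, hxy, he]⟩)
            simp only [hx, hy, if_true, if_false]; omega
        · simp only [hx, if_false]
          split_ifs <;> omega, rfl⟩
    rw [Finset.sum_add_distrib, Finset.sum_sub_distrib, Finset.sum_boole, Finset.sum_boole,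
      Finset.filter_univ_mem, Finset.filter_univ_mem] at this
    omega
  obtain ⟨f, hf, hft⟩ := (Finset.all_card_le_biUnion_card_iff_exists_injective t).1 hall
  refine ⟨u, v, f, Finite.injective_iff_bijective.1 hf, huv, fun x => ?_⟩
  have := hft x
  simpa [t] using this

theorem le_dk_aux {β : Type*} [Fintype β] [PartialOrder β] (k : ℕ) (A : Fin k → Set β)
    (hA : ∀ i, IsAntichain (· ≤ ·) (A i)) : (⋃ i, A i).ncard ≤ dk β k := by
  apply le_csSup
  · refine ⟨Nat.card β, ?_⟩
    rintro n ⟨A, _, rfl⟩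
    exact Set.ncard_le_card _
  · exact ⟨A, hA, rfl⟩

open Classical in
/-- If `u` is strictly increasing on `T` with few values, then `T` is nearly a `k`-family. -/
theorem levels_aux {β : Type*} [Fintype β] [PartialOrder β] (k : ℕ) (T : Finset β) (u : β → ℤ)
    (lo a : ℤ) (ha : 0 ≤ a) (hlo : ∀ q ∈ T, lo ≤ u q) (hhi : ∀ q ∈ T, u q < lo + k + a)
    (hmono : ∀ p ∈ T, ∀ q ∈ T, p < q → u p < u q) :
    (T.card : ℤ) ≤ dk β k + (Fintype.card β + 1) * a := by
  let A : Fin k → Set β := fun i => {q | q ∈ T ∧ u q = lo + (i : ℕ)}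
  have hA : ∀ i, IsAntichain (· ≤ ·) (A i) := by
    intro i p hp q hq hne hle
    have := hmono p hp.1 q hq.1 (lt_of_le_of_ne hle hne)
    have h1 := hp.2
    have h2 := hq.2
    omega
  have h1 := le_dk_aux k A hA
  rcases ha.eq_or_lt with rfl | hpos
  · have : (⋃ i, A i) = (T : Set β) := by
      ext q
      simp only [Set.mem_iUnion, A, Set.mem_ofPred_eq, Finset.mem_coe]
      constructor
      · rintro ⟨_, h, _⟩; exact h
      · intro h
        have h2 := hlo q h
        have h3 := hhi q h
        exact ⟨⟨(u q - lo).toNat, by omega⟩, h, by simp; omega⟩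
    rw [this, Set.ncard_coe_finset] at h1
    simp; exact_mod_cast h1
  · have : T.card ≤ Fintype.card β := Finset.card_le_univ T
    have h2 : (T.card : ℤ) ≤ Fintype.card β := by exact_mod_cast this
    have h3 : (0 : ℤ) ≤ dk β k := by positivity
    nlinarith

open Classical in
/-- Existence of a `k`-saturated family of chains (Greene–Kleitman). -/
theorem greene_kleitman_aux (β : Type*) [Fintype β] [PartialOrder β] (k : ℕ) :
    ∃ (M : Finset (Option β)) (D : Option β → Set β) (F : Finset β),
      (∀ s, IsChain (· ≤ ·) (D s)) ∧ (∀ q, q ∈ F ∨ ∃ s ∈ M, q ∈ D s) ∧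
      F.card + k * M.card ≤ dk β k := by
  let X := β ⊕ Option β
  let E : X → X → Prop := fun x y => ∀ p q, x = .inl p → y = .inl q → p ≤ q
  let c : X → X → ℤ := fun x y => Sum.elim (fun p => if y = .inl p then 1 else 0)
    (fun _ => if y.isLeft then (k : ℤ) else 0) x
  obtain ⟨u, v, f, hf, huv, htight⟩ := egervary_aux E c
    (by rintro x p q h1 h2; rw [h1] at h2; exact (Sum.inl_injective h2).le)
    (by rintro (x | x) y <;> simp only [c, Sum.elim_inl, Sum.elim_inr] <;> split_ifs <;> simp)
  let F : Finset β := Finset.univ.filter fun p => f (.inl p) = .inl p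
  let M : Finset (Option β) := Finset.univ.filter fun s => (f (.inr s)).isLeft
  let step : β → β → Prop := fun p q => f (.inl p) = .inl q
  let D : Option β → Set β := fun s => {q | ∃ p, f (.inr s) = .inl p ∧ Relation.ReflTransGen step p q}
  have hstep : ∀ p q, step p q → p ≤ q := fun p q h => (htight (.inl p)).1 p q rfl h
  have hreach : ∀ p q, Relation.ReflTransGen step p q → p ≤ q := by
    intro p q h
    induction h with
    | refl => exact le_rfl
    | tail _ h ih => exact ih.trans (hstep _ _ h)
  refine ⟨M, D, F, ?_, ?_, ?_⟩
  · rintro s p ⟨p0, hp0, hp⟩ q ⟨q0, hq0, hq⟩ _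
    rw [hp0] at hq0
    obtain rfl := Sum.inl_injective hq0
    have hu : Relator.RightUnique step := by
      intro a b c hb hc
      exact Sum.inl_injective (hb.symm.trans hc)
    exact (Relation.ReflTransGen.total_of_right_unique hu hp hq).imp (hreach _ _) (hreach _ _)
  · intro q
    induction q using WellFoundedLT.induction with
    | ind q ih =>
      by_cases hq : q ∈ F
      · exact .inl hq
      right
      obtain ⟨x, hx⟩ := hf.2 (.inl q)
      rcases x with p | s
      · have hle := hstep p q hx
        have hne : p ≠ q := by
          rintro rfl
          exact hq (by simp [F, hx])
        rcases ih p (lt_of_le_of_ne hle hne) with hp | ⟨s, hs, p0, hp0, hp⟩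
        · exfalso
          have hp : f (.inl p) = .inl p := by simpa [F] using hp
          exact hne (Sum.inl_injective (hp.symm.trans hx))
        · exact ⟨s, hs, p0, hp0, hp.tail hx⟩
      · exact ⟨s, by simp [M, hx], q, hx, .refl⟩
  · have hsum : ∑ x, u x + ∑ x, v x = F.card + k * M.card := by
      have h1 : ∑ x, v x = ∑ x, v (f x) := (hf.sum_comp v).symm
      rw [h1, ← Finset.sum_add_distrib, Finset.sum_congr rfl fun x _ => (htight x).2,
        Fintype.sum_sum_type]
      simp only [c, Sum.elim_inl, Sum.elim_inr]
      rw [Finset.sum_boole, ← Finset.sum_filter, Finset.sum_const]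
      simp [F, M, mul_comm]
    obtain ⟨s, hs⟩ := Finite.exists_max fun s : Option β => u (.inr s)
    obtain ⟨r, hr⟩ := Finite.exists_max fun s : Option β => v (.inr s)
    set A := u (.inr s) with hAdef
    set B := v (.inr r) with hBdef
    have hAB : A + B ≤ 0 := by
      have := huv (.inr s) (.inr r) (by intro p q h; cases h)
      simpa [c] using this
    have hu : ∀ q, u (.inl q) + B ≤ 0 := by
      intro q
      have := huv (.inl q) (.inr r) (by intro p q _ h; cases h)
      simpa [c] using this
    have hv : ∀ q, A + v (.inl q) ≤ k := by
      intro q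
      have := huv (.inr s) (.inl q) (by intro p q h; cases h)
      simpa [c] using this
    have hw : ∀ q, u (.inl q) + v (.inl q) ≤ 1 := by
      intro q
      have := huv (.inl q) (.inl q)
        (by intro a b h1 h2; rw [h1] at h2; exact (Sum.inl_injective h2).le)
      simpa [c] using this
    have hlt : ∀ p q, p < q → u (.inl p) + v (.inl q) ≤ 0 := by
      intro p q hpq
      have := huv (.inl p) (.inl q)
        (by intro a b h1 h2; cases h1; cases h2; exact hpq.le)
      have hne : (Sum.inl q : X) ≠ Sum.inl p := fun h => hpq.ne' (Sum.inl_injective h)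
      simp only [c, Sum.elim_inl, if_neg hne] at this
      exact this
    let T : Finset β := Finset.univ.filter fun q => u (.inl q) + v (.inl q) = 1
    have hT : ∀ q, q ∈ T ↔ u (.inl q) + v (.inl q) = 1 := by simp [T]
    have hlev := levels_aux k T (fun q => u (.inl q)) (1 - k + A) (-(A + B)) (by omega)
      (by intro q hq; have := (hT q).1 hq; have := hv q; omega)
      (by intro q hq; have := hu q; omega)
      (by
        intro p hp q hq hpq
        have := (hT q).1 hq
        have := hlt p q hpq
        omega)
    have hbound : ∑ x, u x + ∑ x, v x ≤ T.card + (Fintype.card β + 1) * (A + B) := by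
      rw [← Finset.sum_add_distrib, Fintype.sum_sum_type]
      apply add_le_add
      · calc ∑ q, (u (.inl q) + v (.inl q))
            ≤ ∑ q, (if u (.inl q) + v (.inl q) = 1 then 1 else 0 : ℤ) := by
              apply Finset.sum_le_sum
              intro q _
              have := hw q
              split_ifs <;> omega
          _ = T.card := by rw [Finset.sum_boole]
      · calc ∑ s', (u (.inr s') + v (.inr s'))
            ≤ ∑ _s' : Option β, (A + B) := Finset.sum_le_sum fun x _ => add_le_add (hs x) (hr x)
          _ = (Fintype.card β + 1) * (A + B) := by simp
    have : (F.card : ℤ) + k * M.card ≤ dk β k := by rw [← hsum]; linarith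
    exact_mod_cast this

theorem chain_cover_aux {α β : Type*} [Fintype α] [PartialOrder α] [Fintype β] [PartialOrder β]
    (C : Set α) (hC : IsChain (· ≤ ·) C) :
    ∃ U : Fin (dk β C.ncard) → Set (α × β),
      (∀ i, IsUnichain (U i)) ∧ ∀ p ∈ C, ∀ q, ∃ i, (p, q) ∈ U i := by
  classical
  rcases C.eq_empty_or_nonempty with rfl | ⟨p0, hp0⟩
  · have h0 : dk β (∅ : Set α).ncard = 0 := by rw [Set.ncard_empty]; simp [dk]
    rw [h0]
    exact ⟨fun _ => ∅, fun i => i.elim0, by simp⟩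
  obtain ⟨M, D, F, hD, hcov, hcard⟩ := greene_kleitman_aux β C.ncard
  let V : F ⊕ (C × M) → Set (α × β) := Sum.elim (fun q => C ×ˢ {q.1})
    (fun x => {x.1.1} ×ˢ D x.2.1)
  have hV : ∀ i, IsUnichain (V i) := by
    rintro (q | x)
    · exact .inr ⟨_, _, hC, rfl⟩
    · exact .inl ⟨_, _, hD _, rfl⟩
  have hle : Fintype.card (F ⊕ (C × M)) ≤ Fintype.card (Fin (dk β C.ncard)) := by
    simp only [Fintype.card_sum, Fintype.card_prod, Fintype.card_coe, Fintype.card_fin]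
    have hk : Fintype.card C = C.ncard := by
      rw [← Nat.card_coe_set_eq, Nat.card_eq_fintype_card]
    rw [hk]
    exact hcard
  obtain ⟨e⟩ := Function.Embedding.nonempty_of_card_le hle
  refine ⟨Function.extend e V fun _ => {p0} ×ˢ ∅, ?_, ?_⟩
  · intro i
    by_cases h : ∃ j, e j = i
    · obtain ⟨j, rfl⟩ := h
      rw [e.injective.extend_apply]
      exact hV j
    · rw [Function.extend_apply' _ _ _ h]
      exact .inl ⟨p0, ∅, by simp [IsChain], rfl⟩
  · intro p hp q
    rcases hcov q with hq | ⟨s, hs, hq⟩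
    · refine ⟨e (.inl ⟨q, hq⟩), ?_⟩
      rw [e.injective.extend_apply]
      simp [V, hp]
    · refine ⟨e (.inr (⟨p, hp⟩, ⟨s, hs⟩)), ?_⟩
      rw [e.injective.extend_apply]
      simp [V, hq]

/-- If `𝒞` is a covering of `P` by chains, then `P × Q` has a unichain
covering of size `∑_{C ∈ 𝒞} d_{|C|}(Q)`. -/
theorem exists_unichain_cover_of_chain_cover
    (α β : Type) [Fintype α] [PartialOrder α] [Fintype β] [PartialOrder β]
    (𝒞 : Finset (Set α)) (hchain : ∀ C ∈ 𝒞, IsChain (· ≤ ·) C)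
    (hcover : (⋃ C ∈ 𝒞, C) = Set.univ) :
    ∃ U : Fin (∑ C ∈ 𝒞, dk β C.ncard) → Set (α × β),
      (∀ i, IsUnichain (U i)) ∧ (⋃ i, U i) = Set.univ := by
  choose! U hU hcov using fun (C : 𝒞) => chain_cover_aux (β := β) C.1 (hchain C.1 C.2)
  have hcard : Fintype.card (Σ C : 𝒞, Fin (dk β C.1.ncard)) = ∑ C ∈ 𝒞, dk β C.ncard := by
    rw [Fintype.card_sigma]
    simp only [Fintype.card_fin]
    exact Finset.sum_coe_sort 𝒞 fun C => dk β C.ncard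
  let e := Fintype.equivFinOfCardEq hcard
  refine ⟨fun i => U (e.symm i).1 (e.symm i).2, fun i => hU _ _, ?_⟩
  rw [Set.eq_univ_iff_forall]
  rintro ⟨p, q⟩
  have hp : p ∈ ⋃ C ∈ 𝒞, C := hcover ▸ Set.mem_univ p
  simp only [Set.mem_iUnion] at hp
  obtain ⟨C, hC, hp⟩ := hp
  obtain ⟨i, hi⟩ := hcov ⟨C, hC⟩ p hp q
  rw [Set.mem_iUnion]
  refine ⟨e ⟨⟨C, hC⟩, i⟩, ?_⟩
  rw [e.symm_apply_apply]
  exact hi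
end
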